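/- Let (G,σ) be a 2-edge-connected signed graph such that G⁺ is connected, and let S ⊆ E⁻(G,σ) with |S| even. Then there exists a family 𝓕 of signed-circuits of (G,σ) such that: (i) every edge of S lies in some member of 𝓕, and for every 2-edge-cut R of G with R ∩ S ≠ ∅ both edges of R lie in members of 𝓕; and (ii) 2ℓ(𝓕) ≤ 3|E(G)| − |E(Ĝ⁺)| − τ(G,σ), where Ĝ⁺ is the maximal bridgeless subgraph of G⁺. -/

import Mathlib

open SimpleGraph Set

variable {V : Type*}

/-- `J` is a `T`-join of `G`: a set of edges of `G` such that a vertex has odd degree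
in the spanning subgraph with edge set `J` iff it belongs to `T`. -/
def IsTJoin (G : SimpleGraph V) (T : Set V) (J : Set (Sym2 V)) : Prop :=
  J ⊆ G.edgeSet ∧ ∀ v : V, (Odd {e ∈ J | v ∈ e}.ncard ↔ v ∈ T)

/-- The edge set of the maximal bridgeless subgraph of `G`: all non-bridge edges. -/
def nonBridgeEdges (G : SimpleGraph V) : Set (Sym2 V) :=
  {e ∈ G.edgeSet | ¬ G.IsBridge e}

/-- A graph is 2-edge-connected if it is connected, has at least two vertices,
and has no bridge. -/
def TwoEdgeConnected (G : SimpleGraph V) : Prop :=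
  G.Connected ∧ Nontrivial V ∧ ∀ e, ¬ G.IsBridge e

/-- `H` is the edge set of an even subgraph of `G`: every vertex has even degree. -/
def IsEvenEdgeSet (G : SimpleGraph V) (H : Set (Sym2 V)) : Prop :=
  H ⊆ G.edgeSet ∧ ∀ v : V, Even {e ∈ H | v ∈ e}.ncard

/-! Signed graphs: a signature is `σ : Sym2 V → Bool`, `σ e = true` meaning `e` is negative. -/

/-- The set of negative edges of `(G, σ)`. -/
def negEdgeSet (G : SimpleGraph V) (σ : Sym2 V → Bool) : Set (Sym2 V) :=
  {e ∈ G.edgeSet | σ e = true}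

/-- The set of positive edges of `(G, σ)`. -/
def posEdgeSet (G : SimpleGraph V) (σ : Sym2 V → Bool) : Set (Sym2 V) :=
  {e ∈ G.edgeSet | σ e = false}

/-- `G⁺`: the spanning subgraph of `G` on the positive edges. -/
def gplus (G : SimpleGraph V) (σ : Sym2 V → Bool) : SimpleGraph V :=
  G.deleteEdges {e | σ e = true}

/-- `C` is the edge set and `S` the vertex set of a cycle of `G`. -/
def IsCycleSet (G : SimpleGraph V) (C : Set (Sym2 V)) (S : Set V) : Prop :=
  ∃ (v : V) (w : G.Walk v v), w.IsCycle ∧ C = {e | e ∈ w.edges} ∧ S = {x | x ∈ w.support}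

/-- `C` (with vertex set `S`) is a negative cycle: it has an odd number of negative edges. -/
def IsNegCycle (G : SimpleGraph V) (σ : Sym2 V → Bool) (C : Set (Sym2 V)) (S : Set V) : Prop :=
  IsCycleSet G C S ∧ Odd {e ∈ C | σ e = true}.ncard

/-- `C` is (the edge set of) a positive cycle: it has an even number of negative edges. -/
def IsPosCycle (G : SimpleGraph V) (σ : Sym2 V → Bool) (C : Set (Sym2 V)) : Prop :=
  (∃ S, IsCycleSet G C S) ∧ Even {e ∈ C | σ e = true}.ncard

/-- `B` is a short barbell whose two negative cycles have edge sets `C₁` and `C₂`: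
the two negative cycles meet in exactly one vertex. -/
def IsShortBarbellWith (G : SimpleGraph V) (σ : Sym2 V → Bool)
    (B C₁ C₂ : Set (Sym2 V)) : Prop :=
  ∃ S₁ S₂, IsNegCycle G σ C₁ S₁ ∧ IsNegCycle G σ C₂ S₂ ∧
    (∃ v, S₁ ∩ S₂ = {v}) ∧ B = C₁ ∪ C₂

/-- `B` is a long barbell whose two negative cycles have edge sets `C₁` and `C₂`:
two vertex-disjoint negative cycles joined by a path meeting them only in its endpoints. -/
def IsLongBarbellWith (G : SimpleGraph V) (σ : Sym2 V → Bool)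
    (B C₁ C₂ : Set (Sym2 V)) : Prop :=
  ∃ (S₁ S₂ : Set V) (u v : V) (p : G.Walk u v), IsNegCycle G σ C₁ S₁ ∧ IsNegCycle G σ C₂ S₂ ∧
    Disjoint S₁ S₂ ∧ p.IsPath ∧ u ∈ S₁ ∧ v ∈ S₂ ∧
    {x | x ∈ p.support} ∩ S₁ = {u} ∧ {x | x ∈ p.support} ∩ S₂ = {v} ∧
    B = C₁ ∪ C₂ ∪ {e | e ∈ p.edges}

/-- `B` is a barbell whose two negative cycles have edge sets `C₁` and `C₂`. -/
def IsBarbellWith (G : SimpleGraph V) (σ : Sym2 V → Bool) (B C₁ C₂ : Set (Sym2 V)) : Prop :=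
  IsShortBarbellWith G σ B C₁ C₂ ∨ IsLongBarbellWith G σ B C₁ C₂

/-- `B` is (the edge set of) a barbell of `(G, σ)`. -/
def IsBarbell (G : SimpleGraph V) (σ : Sym2 V → Bool) (B : Set (Sym2 V)) : Prop :=
  ∃ C₁ C₂, IsBarbellWith G σ B C₁ C₂

/-- A signed-circuit is a positive cycle or a barbell. -/
def IsSignedCircuit (G : SimpleGraph V) (σ : Sym2 V → Bool) (D : Set (Sym2 V)) : Prop :=
  IsPosCycle G σ D ∨ IsBarbell G σ D

open Classical in
/-- `τ(G,σ)`: `|E(G)|` if there is no barbell, otherwise the minimum over all barbells of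
the total number of edges of its two negative cycles. -/
noncomputable def tau (G : SimpleGraph V) (σ : Sym2 V → Bool) : ℕ :=
  if ∃ B, IsBarbell G σ B then
    sInf {n | ∃ B C₁ C₂, IsBarbellWith G σ B C₁ C₂ ∧ n = C₁.ncard + C₂.ncard}
  else G.edgeSet.ncard

/-- The length of a family of signed-circuits (counted with multiplicity). -/
noncomputable def circuitLength (𝓕 : Multiset (Set (Sym2 V))) : ℕ := (𝓕.map Set.ncard).sum

/-- `𝓕` is a signed-circuit cover of `(G, σ)`. -/
def IsSignedCircuitCover (G : SimpleGraph V) (σ : Sym2 V → Bool)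
    (𝓕 : Multiset (Set (Sym2 V))) : Prop :=
  (∀ C ∈ 𝓕, IsSignedCircuit G σ C) ∧ ∀ e ∈ G.edgeSet, ∃ C ∈ 𝓕, e ∈ C

/-- `e` has exactly one endpoint in `U`. -/
def Crosses (U : Set V) (e : Sym2 V) : Prop :=
  ∃ x y, e = s(x, y) ∧ x ∈ U ∧ y ∉ U

open Classical in
/-- The signature obtained from `σ` by switching at the vertex set `U`. -/
noncomputable def switchSign (σ : Sym2 V → Bool) (U : Set V) : Sym2 V → Bool :=
  fun e => if Crosses U e then !(σ e) else σ e

/-- Two signatures are equivalent if one is obtained from the other by switching. -/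
def EquivSign (σ σ' : Sym2 V → Bool) : Prop := ∃ U : Set V, σ' = switchSign σ U

/-- The minimum number of negative edges lying entirely inside `W`, over all signatures
equivalent to `σ` (the negativeness of the signed subgraph induced on `W`). -/
noncomputable def negOn (G : SimpleGraph V) (σ : Sym2 V → Bool) (W : Set V) : ℕ :=
  sInf {n | ∃ U : Set V,
    n = {e | e ∈ G.edgeSet ∧ (∀ x ∈ e, x ∈ W) ∧ switchSign σ U e = true}.ncard}

/-- The negativeness `ε(G,σ)`. -/
noncomputable def negativeness (G : SimpleGraph V) (σ : Sym2 V → Bool) : ℕ :=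
  negOn G σ Set.univ

/-- The signed subgraph induced on `W` is balanced. -/
def BalancedOn (G : SimpleGraph V) (σ : Sym2 V → Bool) (W : Set V) : Prop :=
  negOn G σ W = 0

/-- `(G, σ)` is flow-admissible: each connected component has negativeness ≠ 1, and
for every bridge, neither of the two components obtained by deleting it is balanced. -/
def FlowAdmissible (G : SimpleGraph V) (σ : Sym2 V → Bool) : Prop :=
  ∀ x : V,
    negOn G σ {y | G.Reachable x y} ≠ 1 ∧
    ∀ e ∈ G.edgeSet, G.IsBridge e → (∀ z ∈ e, G.Reachable x z) →
      ∀ z ∈ e, ¬ BalancedOn G σ {y | (G.deleteEdges {e}).Reachable z y}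

/-- `{e, f}` is a 2-edge-cut of `G`. -/
def IsTwoEdgeCut (G : SimpleGraph V) (e f : Sym2 V) : Prop :=
  e ∈ G.edgeSet ∧ f ∈ G.edgeSet ∧ e ≠ f ∧ ¬ G.IsBridge e ∧ ¬ G.IsBridge f ∧
    ¬ (G.deleteEdges {e, f}).Connected


section Aux
open Classical

/-- Incidence vector over `ZMod 2` of an edge, pushed forward along `f`. -/
noncomputable def incv {V W : Type*} (f : V → W) (e : Sym2 V) : W → ZMod 2 :=
  Sym2.lift ⟨fun y z => Pi.single (f y) 1 + Pi.single (f z) 1, fun _ _ => add_comm _ _⟩ e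

/-- Boundary over `ZMod 2` of an edge set, pushed forward along `f`. -/
noncomputable def bdm {V W : Type*} (f : V → W) (J : Finset (Sym2 V)) : W → ZMod 2 :=
  ∑ e ∈ J, incv f e

lemma incv_mk {V W : Type*} (f : V → W) (y z : V) :
    incv f s(y, z) = Pi.single (f y) 1 + Pi.single (f z) 1 := rfl

lemma z2_add_self {W : Type*} (g : W → ZMod 2) : g + g = 0 := by
  ext x; exact CharTwo.add_self_eq_zero _

lemma z2_cases (x : ZMod 2) : x = 0 ∨ x = 1 := by
  revert x; decide

lemma bdm_empty {V W : Type*} (f : V → W) : bdm f ∅ = 0 := by simp [bdm]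

lemma bdm_union {V W : Type*} (f : V → W) {J K : Finset (Sym2 V)} (h : Disjoint J K) :
    bdm f (J ∪ K) = bdm f J + bdm f K := by
  simp [bdm, Finset.sum_union h]

lemma bdm_sdiff {V W : Type*} (f : V → W) {J K : Finset (Sym2 V)} (h : K ⊆ J) :
    bdm f (J \ K) = bdm f J + bdm f K := by
  have h1 : bdm f (J \ K) + bdm f K = bdm f J := Finset.sum_sdiff h
  rw [← h1, add_assoc, z2_add_self, add_zero]

lemma bdm_symmDiff {V W : Type*} (f : V → W) (J K : Finset (Sym2 V)) :
    bdm f (symmDiff J K) = bdm f J + bdm f K := by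
  have h1 : symmDiff J K = (J ∪ K) \ (J ∩ K) := by
    ext x; simp [Finset.mem_symmDiff]; tauto
  rw [h1, bdm_sdiff]
  · exact Finset.sum_union_inter
  · exact Finset.inter_subset_union

lemma bdm_erase {V W : Type*} (f : V → W) {J : Finset (Sym2 V)} {e : Sym2 V} (h : e ∈ J) :
    bdm f (J.erase e) = bdm f J + incv f e := by
  rw [Finset.erase_eq, bdm_sdiff f (by simpa using h)]
  simp [bdm]

lemma walk_inc {V W : Type*} {G : SimpleGraph V} (f : V → W) {u v : V} (w : G.Walk u v) :
    (w.edges.map (incv f)).sum = Pi.single (f u) 1 + Pi.single (f v) 1 := by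
  induction w with
  | nil => simp [z2_add_self]
  | @cons a b c h p ih =>
    rw [SimpleGraph.Walk.edges_cons, List.map_cons, List.sum_cons, ih, incv_mk]
    have := z2_add_self (Pi.single (f b) (1 : ZMod 2))
    calc _ = Pi.single (f a) 1 + Pi.single (f c) 1 +
        (Pi.single (f b) (1 : ZMod 2) + Pi.single (f b) (1 : ZMod 2)) := by abel
      _ = _ := by rw [this, add_zero]

lemma trail_bdm {V W : Type*} {G : SimpleGraph V} (f : V → W) {u v : V} (w : G.Walk u v)
    (hw : w.IsTrail) :
    bdm f w.edges.toFinset = Pi.single (f u) 1 + Pi.single (f v) 1 := by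
  rw [bdm, List.sum_toFinset _ hw.edges_nodup, walk_inc]

/-- A finset of edges of `G`. -/
def ESub {V : Type*} (G : SimpleGraph V) (J : Finset (Sym2 V)) : Prop := ∀ e ∈ J, e ∈ G.edgeSet

lemma trail_exists {V : Type*} {G : SimpleGraph V} (n : ℕ) :
    ∀ J : Finset (Sym2 V), J.card = n → ESub G J → ∀ v, bdm id J v = 1 →
      ∃ u, u ≠ v ∧ bdm id J u = 1 ∧ ∃ p : G.Walk v u, p.IsTrail ∧ p.edges.toFinset ⊆ J := by
  induction n with
  | zero =>
    intro J hJ _ v hv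
    rw [Finset.card_eq_zero] at hJ
    simp [hJ, bdm] at hv
  | succ n ih =>
    intro J hJ hG v hv
    obtain ⟨e, he, hev⟩ : ∃ e ∈ J, incv id e v ≠ 0 := by
      by_contra hcon
      push Not at hcon
      have : bdm id J v = 0 := by
        rw [bdm, Finset.sum_apply]
        exact Finset.sum_eq_zero hcon
      rw [this] at hv
      exact absurd hv (by decide)
    obtain ⟨w, rfl⟩ : ∃ w, e = s(v, w) := by
      induction e with
      | h a b =>
        rw [incv_mk] at hev
        by_cases ha : v = a
        · exact ⟨b, by rw [ha]⟩
        · by_cases hb : v = b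
          · exact ⟨a, by rw [hb, Sym2.eq_swap]⟩
          · simp [ha, hb] at hev
    have hadj : G.Adj v w := hG _ he
    have hne : v ≠ w := hadj.ne
    rcases z2_cases (bdm id J w) with hw | hw
    · have hb := bdm_erase (id : V → V) he
      have hJ' : (J.erase s(v, w)).card = n := by
        rw [Finset.card_erase_of_mem he, hJ]; rfl
      obtain ⟨u, huw, hu, p, hp, hpJ⟩ := ih (J.erase s(v, w)) hJ'
        (fun e he => hG e (Finset.mem_of_mem_erase he)) w (by
          rw [hb, incv_mk]; simp [hw, hne.symm])
      have huv : u ≠ v := by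
        rintro rfl
        rw [hb, incv_mk] at hu
        simp [hv, hne] at hu
      refine ⟨u, huv, ?_, SimpleGraph.Walk.cons hadj p, ?_, ?_⟩
      · rw [hb, incv_mk] at hu
        simpa [huv, huw] using hu
      · rw [SimpleGraph.Walk.isTrail_cons]
        refine ⟨hp, fun hmem => ?_⟩
        have := hpJ (List.mem_toFinset.2 hmem)
        simp at this
      · intro e he'
        simp only [SimpleGraph.Walk.edges_cons, List.toFinset_cons, Finset.mem_insert] at he'
        rcases he' with rfl | he'
        · exact he
        · exact Finset.mem_of_mem_erase (hpJ he')
    · refine ⟨w, hne.symm, hw, hadj.toWalk, ?_, ?_⟩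
      · simp [SimpleGraph.Adj.toWalk]
      · intro e he'
        simp [SimpleGraph.Adj.toWalk] at he'
        rw [he']; exact he

lemma even_edge {V : Type*} {G : SimpleGraph V} {H : Finset (Sym2 V)} (hG : ESub G H)
    (hb : bdm id H = 0) {u v : V} (he : s(u, v) ∈ H) :
    ∃ p : G.Walk u v, p.IsPath ∧ p.edges.toFinset ⊆ H.erase s(u, v) := by
  have hadj : G.Adj u v := hG _ he
  have hb' := bdm_erase (id : V → V) he
  rw [hb, incv_mk, zero_add] at hb'
  obtain ⟨x, hxu, hx, p, hp, hpJ⟩ := trail_exists _ (H.erase s(u, v)) rfl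
    (fun e he => hG e (Finset.mem_of_mem_erase he)) u (by rw [hb']; simp [hadj.ne])
  have : x = v := by
    by_contra hxv
    rw [hb'] at hx
    simp [hxu, hxv] at hx
  subst this
  refine ⟨p.bypass, p.bypass_isPath, fun e he => hpJ ?_⟩
  rw [List.mem_toFinset] at he ⊢
  exact p.edges_bypass_subset_edges he

/-- `C` is the edge finset of a cycle. -/
def CycF {V : Type*} (G : SimpleGraph V) (C : Finset (Sym2 V)) : Prop :=
  ∃ (v : V) (w : G.Walk v v), w.IsCycle ∧ w.edges.toFinset = C

/-- Vertices covered by `C`. -/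
def vts {V : Type*} (C : Finset (Sym2 V)) : Set V := {x | ∃ e ∈ C, x ∈ e}

/-- Number of negative edges. -/
def negc {V : Type*} (σ : Sym2 V → Bool) (C : Finset (Sym2 V)) : ℕ :=
  (C.filter (fun e => σ e = true)).card

lemma negc_ncard {V : Type*} (σ : Sym2 V → Bool) (C : Finset (Sym2 V)) :
    {e ∈ (C : Set (Sym2 V)) | σ e = true}.ncard = negc σ C := by
  rw [negc, ← Set.ncard_coe_finset]; congr 1; ext; simp

lemma negc_union {V : Type*} (σ : Sym2 V → Bool) {C D : Finset (Sym2 V)} (h : Disjoint C D) :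
    negc σ (C ∪ D) = negc σ C + negc σ D := by
  rw [negc, Finset.filter_union, Finset.card_union_of_disjoint
    (Finset.disjoint_filter_filter h)]; rfl

lemma negc_sdiff {V : Type*} (σ : Sym2 V → Bool) {C D : Finset (Sym2 V)} (h : C ⊆ D) :
    negc σ D = negc σ (D \ C) + negc σ C := by
  rw [← negc_union σ Finset.sdiff_disjoint, Finset.sdiff_union_of_subset h]

lemma cyc_supp {V : Type*} {G : SimpleGraph V} {v : V} {w : G.Walk v v} (hw : w.IsCycle) :
    {x | x ∈ w.support} = vts w.edges.toFinset := by
  ext x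
  simp only [Set.mem_ofPred_eq, vts, List.mem_toFinset]
  exact SimpleGraph.Walk.mem_support_iff_exists_mem_edges_of_not_nil hw.not_nil

lemma CycF.isCycleSet {V : Type*} {G : SimpleGraph V} {C : Finset (Sym2 V)} (h : CycF G C) :
    IsCycleSet G (C : Set (Sym2 V)) (vts C) := by
  obtain ⟨v, w, hw, rfl⟩ := h
  refine ⟨v, w, hw, by simp, (cyc_supp hw).symm⟩

lemma CycF.bdm {V W : Type*} {G : SimpleGraph V} {C : Finset (Sym2 V)} (h : CycF G C)
    (f : V → W) : bdm f C = 0 := by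
  obtain ⟨v, w, hw, rfl⟩ := h
  rw [trail_bdm f w hw.isTrail, z2_add_self]

lemma CycF.esub {V : Type*} {G : SimpleGraph V} {C : Finset (Sym2 V)} (h : CycF G C) :
    ESub G C := by
  obtain ⟨v, w, hw, rfl⟩ := h
  intro e he
  exact w.edges_subset_edgeSet (List.mem_toFinset.1 he)

lemma CycF.nonempty {V : Type*} {G : SimpleGraph V} {C : Finset (Sym2 V)} (h : CycF G C) :
    C.Nonempty := by
  obtain ⟨v, w, hw, rfl⟩ := h
  cases w with
  | nil => exact absurd hw (by simp)
  | cons h p => exact ⟨_, by simp; exact Or.inl rfl⟩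

lemma even_cycle {V : Type*} {G : SimpleGraph V} {H : Finset (Sym2 V)} (hG : ESub G H)
    (hb : bdm id H = 0) (hne : H.Nonempty) : ∃ C, CycF G C ∧ C ⊆ H := by
  obtain ⟨e, he⟩ := hne
  induction e with
  | h u v =>
    obtain ⟨p, hp, hpH⟩ := even_edge hG hb he
    have hadj : G.Adj u v := hG _ he
    refine ⟨_, ⟨v, SimpleGraph.Walk.cons hadj.symm p, ?_, rfl⟩, ?_⟩
    · rw [SimpleGraph.Walk.cons_isCycle_iff]
      refine ⟨hp, fun hm => ?_⟩
      have := hpH (List.mem_toFinset.2 hm)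
      rw [Sym2.eq_swap] at this
      simp at this
    · intro e he'
      simp only [SimpleGraph.Walk.edges_cons, List.toFinset_cons, Finset.mem_insert] at he'
      rcases he' with rfl | he'
      · rwa [Sym2.eq_swap]
      · exact Finset.mem_of_mem_erase (hpH he')

lemma first_hit {V : Type*} {G : SimpleGraph V} (X : Set V) {w v : V} (q : G.Walk w v)
    (hv : v ∈ X) : ∃ x ∈ X, ∃ q' : G.Walk w x, q'.IsPath ∧ q'.edges ⊆ q.edges ∧
      q'.support ⊆ q.support ∧ ∀ y ∈ q'.support, y ∈ X → y = x := by
  suffices h : ∃ x ∈ X, ∃ q' : G.Walk w x, q'.edges ⊆ q.edges ∧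
      q'.support ⊆ q.support ∧ ∀ y ∈ q'.support, y ∈ X → y = x by
    obtain ⟨x, hx, q', h1, h2, h3⟩ := h
    exact ⟨x, hx, q'.bypass, q'.bypass_isPath, fun _ h => h1 (q'.edges_bypass_subset_edges h),
      fun _ h => h2 (q'.support_bypass_subset_support h),
      fun y hy => h3 y (q'.support_bypass_subset_support hy)⟩
  induction q with
  | nil => exact ⟨_, hv, SimpleGraph.Walk.nil, by simp⟩
  | @cons a b c h p ih =>
    by_cases ha : a ∈ X
    · exact ⟨a, ha, SimpleGraph.Walk.nil, by simp⟩
    · obtain ⟨x, hx, q', h1, h2, h3⟩ := ih hv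
      refine ⟨x, hx, SimpleGraph.Walk.cons h q', ?_, ?_, ?_⟩
      · simp only [SimpleGraph.Walk.edges_cons]
        exact List.cons_subset_cons _ h1
      · simp only [SimpleGraph.Walk.support_cons]
        exact List.cons_subset_cons _ h2
      · intro y hy hyX
        simp only [SimpleGraph.Walk.support_cons, List.mem_cons] at hy
        rcases hy with rfl | hy
        · exact absurd hyX ha
        · exact h3 y hy hyX

lemma two_paths {V : Type*} {G : SimpleGraph V} {C : Finset (Sym2 V)} (hC : CycF G C) {u v : V}
    (huv : u ≠ v) (hu : u ∈ vts C) (hv : v ∈ vts C) :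
    ∃ q₁ q₂ : G.Walk u v, q₁.IsPath ∧ q₂.IsPath ∧
      Disjoint q₁.edges.toFinset q₂.edges.toFinset ∧
      q₁.edges.toFinset ∪ q₂.edges.toFinset = C ∧
      (∀ x ∈ q₁.support, x ∈ vts C) ∧ (∀ x ∈ q₂.support, x ∈ vts C) := by
  obtain ⟨a, w, hw, rfl⟩ := hC
  rw [← cyc_supp hw] at hu hv ⊢
  simp only [Set.mem_ofPred_eq] at hu hv ⊢
  have hv' : v ∈ (w.rotate u hu).support := by simpa using hv
  have hc : (w.rotate u hu).IsCycle := hw.rotate hu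
  refine ⟨(w.rotate u hu).takeUntil v hv', ((w.rotate u hu).dropUntil v hv').reverse, 
    hc.isPath_takeUntil hv', ?_, ?_, ?_, ?_, ?_⟩
  · rw [SimpleGraph.Walk.isPath_reverse_iff]
    have hc2 := hc
    rw [← SimpleGraph.Walk.take_spec _ hv'] at hc2
    exact hc2.isPath_of_append_right (SimpleGraph.Walk.not_nil_of_ne huv)
  · have := hc.isTrail.disjoint_edges_takeUntil_dropUntil hv'
    rw [Finset.disjoint_left]
    intro e he he'
    simp only [List.mem_toFinset, SimpleGraph.Walk.edges_reverse, List.mem_reverse] at he he'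
    exact this he he'
  · ext e
    have h1 : e ∈ (w.rotate u hu).edges ↔ e ∈ w.edges := (w.rotate_edges u hu).mem_iff
    simp only [Finset.mem_union, List.mem_toFinset, SimpleGraph.Walk.edges_reverse,
      List.mem_reverse]
    rw [← h1, ← List.mem_append, ← SimpleGraph.Walk.edges_append, SimpleGraph.Walk.take_spec]
  · intro x hx
    have := SimpleGraph.Walk.support_takeUntil_subset_support _ hv' hx
    simpa using this
  · intro x hx
    rw [SimpleGraph.Walk.support_reverse, List.mem_reverse] at hx
    have := SimpleGraph.Walk.support_dropUntil_subset_support _ hv' hx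
    simpa using this

lemma glue_cycle {V : Type*} {G : SimpleGraph V} {u w x : V} (h : G.Adj u w) (q : G.Walk w x)
    (hq : q.IsPath) (s : G.Walk u x) (hs : s.IsPath) (hu : u ∉ q.support)
    (hqs : ∀ y ∈ q.support, y ∈ s.support → y = x) (he : s(u, w) ∉ s.edges) :
    CycF G (insert s(u, w) q.edges.toFinset ∪ s.edges.toFinset) := by
  refine ⟨u, SimpleGraph.Walk.cons h (q.append s.reverse), ?_, ?_⟩
  · rw [SimpleGraph.Walk.cons_isCycle_iff]
    constructor
    · rw [SimpleGraph.Walk.isPath_def, SimpleGraph.Walk.support_append, List.nodup_append]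
      refine ⟨hq.support_nodup, ?_, ?_⟩
      · exact (hs.reverse.support_nodup).tail
      · intro a ha b hb hab
        subst hab
        have hn := hs.reverse.support_nodup
        rw [← SimpleGraph.Walk.cons_tail_support] at hn
        have hax : a = x := by
          apply hqs a ha
          have := List.mem_of_mem_tail hb
          rwa [SimpleGraph.Walk.support_reverse, List.mem_reverse] at this
        subst hax
        exact (List.nodup_cons.1 hn).1 hb
    · rw [SimpleGraph.Walk.edges_append, List.mem_append, SimpleGraph.Walk.edges_reverse,
        List.mem_reverse]
      rintro (h1 | h1)
      · exact hu (SimpleGraph.Walk.fst_mem_support_of_mem_edges _ h1)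
      · exact he h1
  · ext e
    simp [SimpleGraph.Walk.edges_append]

lemma pos_cycle_of_two {V : Type*} {G : SimpleGraph V} (σ : Sym2 V → Bool)
    {C D : Finset (Sym2 V)} (hC : CycF G C) (hD : CycF G D) (hdis : Disjoint C D)
    (hodd : Odd (negc σ D)) {u v : V} (huv : u ≠ v) (huC : u ∈ vts C) (hvC : v ∈ vts C)
    (huD : u ∈ vts D) (hvD : v ∈ vts D) :
    ∃ Z, CycF G Z ∧ Even (negc σ Z) ∧ Z ⊆ C ∪ D := by
  obtain ⟨q, q₀, hq, -, -, hqC, -, -⟩ := two_paths hC huv huC hvC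
  cases q with
  | nil => exact absurd rfl huv
  | @cons _ w _ h r =>
    rw [SimpleGraph.Walk.cons_isPath_iff] at hq
    obtain ⟨x, hx, q', hq', hqe, hqs, hqx⟩ := first_hit (vts D) r hvD
    have hu' : u ∉ q'.support := fun h => hq.2 (hqs h)
    have hux : u ≠ x := by
      rintro rfl
      exact hu' q'.end_mem_support
    obtain ⟨s₁, s₂, hs₁, hs₂, hsd, hsu, hv₁, hv₂⟩ := two_paths hD hux huD hx
    have hPC : insert s(u, w) q'.edges.toFinset ⊆ C := by
      rw [← hqC]
      intro e he
      simp only [Finset.mem_insert, List.mem_toFinset] at he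
      simp only [Finset.mem_union, List.mem_toFinset, SimpleGraph.Walk.edges_cons, List.mem_cons]
      rcases he with he | he
      · exact Or.inl (Or.inl he)
      · exact Or.inl (Or.inr (hqe he))
    have hsD₁ : s₁.edges.toFinset ⊆ D := hsu ▸ Finset.subset_union_left
    have hsD₂ : s₂.edges.toFinset ⊆ D := hsu ▸ Finset.subset_union_right
    have huw : s(u, w) ∈ C := hPC (Finset.mem_insert_self _ _)
    have hnD : s(u, w) ∉ D := Finset.disjoint_left.1 hdis huw
    have c₁ := glue_cycle h q' hq' s₁ hs₁ hu' (fun y h1 h2 => hqx y h1 (hv₁ y h2))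
      (fun h => hnD (hsD₁ (List.mem_toFinset.2 h)))
    have c₂ := glue_cycle h q' hq' s₂ hs₂ hu' (fun y h1 h2 => hqx y h1 (hv₂ y h2))
      (fun h => hnD (hsD₂ (List.mem_toFinset.2 h)))
    have n₁ := negc_union σ (Finset.disjoint_of_subset_left hPC
      (Finset.disjoint_of_subset_right hsD₁ hdis))
    have n₂ := negc_union σ (Finset.disjoint_of_subset_left hPC
      (Finset.disjoint_of_subset_right hsD₂ hdis))
    have n₃ := negc_union σ hsd
    rw [hsu] at n₃
    by_cases hev : Even (negc σ (insert s(u, w) q'.edges.toFinset ∪ s₁.edges.toFinset))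
    · exact ⟨_, c₁, hev, Finset.union_subset_union hPC hsD₁⟩
    · refine ⟨_, c₂, ?_, Finset.union_subset_union hPC hsD₂⟩
      rw [n₁] at hev
      rw [n₂]
      rw [n₃] at hodd
      rw [Nat.even_iff] at *
      rw [Nat.odd_iff] at hodd
      omega

lemma neg_isNeg {V : Type*} {G : SimpleGraph V} {σ : Sym2 V → Bool} {C : Finset (Sym2 V)}
    (hC : CycF G C) (hn : Odd (negc σ C)) : IsNegCycle G σ (C : Set (Sym2 V)) (vts C) :=
  ⟨hC.isCycleSet, by rw [negc_ncard]; exact hn⟩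

lemma long_barbell {V : Type*} {G : SimpleGraph V} {σ : Sym2 V → Bool} {C D : Finset (Sym2 V)}
    (hC : CycF G C) (hD : CycF G D) (hnC : Odd (negc σ C)) (hnD : Odd (negc σ D))
    (hdis : Disjoint (vts C) (vts D)) {u v : V} (hu : u ∈ vts C) (hv : v ∈ vts D)
    (p : G.Walk u v) : ∃ B : Finset (Sym2 V),
      IsBarbellWith G σ (B : Set (Sym2 V)) (C : Set (Sym2 V)) (D : Set (Sym2 V)) ∧
      C ⊆ B ∧ D ⊆ B ∧ B.card ≤ C.card + D.card + p.edges.toFinset.card := by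
  obtain ⟨y, hy, q, -, hqe, -, hqy⟩ := first_hit (vts D) p hv
  obtain ⟨x, hx, r, hr, hre, hrs, hrx⟩ := first_hit (vts C) q.reverse hu
  refine ⟨C ∪ D ∪ r.edges.toFinset, Or.inr ⟨vts C, vts D, x, y, r.reverse, neg_isNeg hC hnC,
    neg_isNeg hD hnD, hdis, hr.reverse, hx, hy, ?_, ?_, ?_⟩, ?_, ?_, ?_⟩
  · ext z
    simp only [SimpleGraph.Walk.support_reverse, List.mem_reverse, Set.mem_inter_iff,
      Set.mem_ofPred_eq, Set.mem_singleton_iff]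
    constructor
    · rintro ⟨h1, h2⟩
      exact hrx z h1 h2
    · rintro rfl
      exact ⟨r.end_mem_support, hx⟩
  · ext z
    simp only [SimpleGraph.Walk.support_reverse, List.mem_reverse, Set.mem_inter_iff,
      Set.mem_ofPred_eq, Set.mem_singleton_iff]
    constructor
    · rintro ⟨h1, h2⟩
      have := hrs h1
      rw [SimpleGraph.Walk.support_reverse, List.mem_reverse] at this
      exact hqy z this h2
    · rintro rfl
      exact ⟨r.start_mem_support, hy⟩
  · ext e
    simp [or_assoc]
  · intro e he; simp [he]
  · intro e he; simp [he]
  · refine (Finset.card_union_le _ _).trans (Nat.add_le_add (Finset.card_union_le _ _) ?_)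
    apply Finset.card_le_card
    intro e he
    rw [List.mem_toFinset] at he ⊢
    have := hre he
    rw [SimpleGraph.Walk.edges_reverse, List.mem_reverse] at this
    exact hqe this

lemma avg_aux {α : Type*} [DecidableEq α] (𝒵 : Finset (Finset α)) (h0 : ∅ ∈ 𝒵)
    (hcl : ∀ A ∈ 𝒵, ∀ B ∈ 𝒵, symmDiff A B ∈ 𝒵) (F : Finset α)
    (hF : ∀ e ∈ F, ∃ Z ∈ 𝒵, e ∈ Z) (J : Finset α) :
    ∃ Z ∈ 𝒵, 2 * ((symmDiff J Z) ∩ F).card ≤ F.card := by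
  have key : ∀ e ∈ F, 2 * (𝒵.filter (fun Z => e ∈ symmDiff J Z)).card = 𝒵.card := by
    intro e he
    obtain ⟨Y, hY, heY⟩ := hF e he
    have hb : (𝒵.filter (fun Z => e ∈ symmDiff J Z)).card =
        (𝒵.filter (fun Z => ¬ e ∈ symmDiff J Z)).card := by
      refine Finset.card_bij' (fun Z _ => symmDiff Z Y) (fun Z _ => symmDiff Z Y) ?_ ?_ ?_ ?_
      · intro Z hZ
        simp only [Finset.mem_filter, Finset.mem_symmDiff] at hZ ⊢
        exact ⟨hcl _ hZ.1 _ hY, by tauto⟩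
      · intro Z hZ
        simp only [Finset.mem_filter, Finset.mem_symmDiff] at hZ ⊢
        exact ⟨hcl _ hZ.1 _ hY, by tauto⟩
      · intro Z _; simp
      · intro Z _; simp
    have := Finset.card_filter_add_card_filter_not (s := 𝒵) (fun Z => e ∈ symmDiff J Z)
    omega
  by_contra hcon
  push Not at hcon
  have h1 : ∑ Z ∈ 𝒵, F.card < ∑ Z ∈ 𝒵, 2 * ((symmDiff J Z) ∩ F).card :=
    Finset.sum_lt_sum_of_nonempty ⟨_, h0⟩ hcon
  have h2 : ∑ Z ∈ 𝒵, 2 * ((symmDiff J Z) ∩ F).card = ∑ Z ∈ 𝒵, F.card := by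
    have h3 : ∑ Z ∈ 𝒵, ((symmDiff J Z) ∩ F).card =
        ∑ e ∈ F, (𝒵.filter (fun Z => e ∈ symmDiff J Z)).card := by
      have := Finset.sum_card_bipartiteAbove_eq_sum_card_bipartiteBelow
        (s := 𝒵) (t := F) (fun Z e => e ∈ symmDiff J Z)
      refine Eq.trans ?_ (this.trans ?_)
      swap
      · refine Finset.sum_congr rfl fun e _ => ?_
        congr 1
      refine Finset.sum_congr rfl fun Z _ => ?_
      congr 1
      ext e
      simp only [Finset.bipartiteAbove, Finset.mem_inter, Finset.mem_filter]
      tauto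
    rw [← Finset.mul_sum, h3, Finset.mul_sum, Finset.sum_congr rfl key]
    simp [mul_comm]
  omega

lemma avg_bd {V : Type*} (M F J : Finset (Sym2 V)) (hJ : J ⊆ M)
    (hF : ∀ e ∈ F, ∃ Z ⊆ M, bdm id Z = 0 ∧ e ∈ Z) :
    ∃ J' ⊆ M, bdm id J' = bdm id J ∧ 2 * (J' ∩ F).card ≤ F.card := by
  obtain ⟨Z, hZ, hc⟩ := avg_aux (M.powerset.filter (fun Z => bdm id Z = 0))
    (by simp [bdm_empty]) (by
      intro A hA B hB
      simp only [Finset.mem_filter, Finset.mem_powerset] at hA hB ⊢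
      refine ⟨?_, by rw [bdm_symmDiff, hA.2, hB.2, add_zero]⟩
      intro x hx
      rw [Finset.mem_symmDiff] at hx
      rcases hx with hx | hx
      · exact hA.1 hx.1
      · exact hB.1 hx.1) F (by
      intro e he
      obtain ⟨Z, h1, h2, h3⟩ := hF e he
      exact ⟨Z, by simp [h1, h2], h3⟩) J
  simp only [Finset.mem_filter, Finset.mem_powerset] at hZ
  refine ⟨symmDiff J Z, ?_, by rw [bdm_symmDiff, hZ.2, add_zero], hc⟩
  intro x hx
  rw [Finset.mem_symmDiff] at hx
  rcases hx with hx | hx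
  · exact hJ hx.1
  · exact hZ.1 hx.1

lemma reach_bd {V : Type*} {G : SimpleGraph V} {u v : V} (h : G.Reachable u v) :
    ∃ K : Finset (Sym2 V), ESub G K ∧ bdm id K = Pi.single u 1 + Pi.single v 1 := by
  obtain ⟨p, hp⟩ := h.exists_isPath
  exact ⟨p.edges.toFinset, fun e he => p.edges_subset_edgeSet (List.mem_toFinset.1 he),
    trail_bdm id p hp.isTrail⟩

lemma esub_symmDiff {V : Type*} {G : SimpleGraph V} {A B : Finset (Sym2 V)} (hA : ESub G A)
    (hB : ESub G B) : ESub G (symmDiff A B) := by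
  intro x hx
  rw [Finset.mem_symmDiff] at hx
  rcases hx with hx | hx
  · exact hA _ hx.1
  · exact hB _ hx.1

/-- An arbitrary edge set has its boundary realized in a connected graph. -/
lemma join_edges {V : Type*} {G : SimpleGraph V} (hG : G.Connected) (S : Finset (Sym2 V)) :
    ∃ K : Finset (Sym2 V), ESub G K ∧ bdm id K = bdm id S := by
  induction S using Finset.induction_on with
  | empty => exact ⟨∅, by simp [ESub], rfl⟩
  | insert e S he ih =>
    obtain ⟨K, hK, hb⟩ := ih
    induction e with
    | h u v =>
      obtain ⟨L, hL, hbL⟩ := reach_bd (hG.preconnected u v)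
      refine ⟨symmDiff L K, esub_symmDiff hL hK, ?_⟩
      rw [bdm_symmDiff, hbL, hb]
      simp [bdm, Finset.sum_insert he, incv_mk]

lemma decomp {V : Type*} {G : SimpleGraph V} (σ : Sym2 V → Bool) (H : Finset (Sym2 V)) :
    ESub G H → bdm id H = 0 →
    ∃ (𝓕 : Multiset (Finset (Sym2 V))) (𝒟 : Finset (Finset (Sym2 V))),
      (∀ C ∈ 𝓕, IsSignedCircuit G σ (C : Set (Sym2 V))) ∧
      (∀ C ∈ 𝒟, CycF G C ∧ Odd (negc σ C) ∧ C ⊆ H) ∧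
      (∀ C ∈ 𝒟, ∀ D ∈ 𝒟, C ≠ D → Disjoint (vts C) (vts D)) ∧
      (∀ e ∈ H, (∃ C ∈ 𝓕, e ∈ C) ∨ ∃ C ∈ 𝒟, e ∈ C) ∧
      (𝓕.map Finset.card).sum + ∑ C ∈ 𝒟, C.card ≤ H.card ∧
      𝒟.card % 2 = negc σ H % 2 := by
  induction H using Finset.strongInduction with
  | H H ih =>
  intro hG hb
  have step : ∀ B : Finset (Sym2 V), B ⊆ H → B.Nonempty → bdm id B = 0 →
      IsSignedCircuit G σ (B : Set (Sym2 V)) → Even (negc σ B) →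
      ∃ (𝓕 : Multiset (Finset (Sym2 V))) (𝒟 : Finset (Finset (Sym2 V))),
      (∀ C ∈ 𝓕, IsSignedCircuit G σ (C : Set (Sym2 V))) ∧
      (∀ C ∈ 𝒟, CycF G C ∧ Odd (negc σ C) ∧ C ⊆ H) ∧
      (∀ C ∈ 𝒟, ∀ D ∈ 𝒟, C ≠ D → Disjoint (vts C) (vts D)) ∧
      (∀ e ∈ H, (∃ C ∈ 𝓕, e ∈ C) ∨ ∃ C ∈ 𝒟, e ∈ C) ∧
      (𝓕.map Finset.card).sum + ∑ C ∈ 𝒟, C.card ≤ H.card ∧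
      𝒟.card % 2 = negc σ H % 2 := by
    intro B hBH hBne hBb hBs hBn
    obtain ⟨𝓕, 𝒟, h1, h2, h3, h4, h5, h6⟩ := ih (H \ B) (Finset.sdiff_ssubset hBH hBne)
      (fun e he => hG e (Finset.sdiff_subset he)) (by rw [bdm_sdiff id hBH, hb, hBb, add_zero])
    refine ⟨B ::ₘ 𝓕, 𝒟, ?_, ?_, h3, ?_, ?_, ?_⟩
    · intro C hC
      rcases Multiset.mem_cons.1 hC with rfl | hC
      · exact hBs
      · exact h1 C hC
    · intro C hC
      exact ⟨(h2 C hC).1, (h2 C hC).2.1, fun e he => Finset.sdiff_subset ((h2 C hC).2.2 he)⟩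
    · intro e he
      by_cases heB : e ∈ B
      · exact Or.inl ⟨B, Multiset.mem_cons_self _ _, heB⟩
      · rcases h4 e (Finset.mem_sdiff.2 ⟨he, heB⟩) with ⟨C, hC, heC⟩ | h
        · exact Or.inl ⟨C, Multiset.mem_cons_of_mem hC, heC⟩
        · exact Or.inr h
    · rw [Multiset.map_cons, Multiset.sum_cons]
      have := Finset.card_sdiff_add_card_eq_card hBH
      omega
    · have := negc_sdiff σ hBH
      rw [Nat.even_iff] at hBn
      omega
  by_cases hpos : ∃ C, CycF G C ∧ Even (negc σ C) ∧ C ⊆ H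
  · obtain ⟨C, hC, hn, hCH⟩ := hpos
    exact step C hCH hC.nonempty (hC.bdm id)
      (Or.inl ⟨⟨_, hC.isCycleSet⟩, by rw [negc_ncard]; exact hn⟩) hn
  by_cases hbar : ∃ C D, CycF G C ∧ CycF G D ∧ Odd (negc σ C) ∧ Odd (negc σ D) ∧ C ⊆ H ∧ D ⊆ H ∧
      Disjoint C D ∧ ∃ x, vts C ∩ vts D = {x}
  · obtain ⟨C, D, hC, hD, hnC, hnD, hCH, hDH, hdis, hx⟩ := hbar
    refine step (C ∪ D) (Finset.union_subset hCH hDH) (hC.nonempty.mono Finset.subset_union_left)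
      (by rw [bdm_union id hdis, hC.bdm, hD.bdm, add_zero]) ?_
      (by rw [negc_union σ hdis]; exact hnC.add_odd hnD)
    exact Or.inr ⟨C, D, Or.inl ⟨_, _, neg_isNeg hC hnC, neg_isNeg hD hnD, hx, by simp⟩⟩
  have hvd : ∀ C D, CycF G C → CycF G D → C ⊆ H → D ⊆ H → Disjoint C D →
      Disjoint (vts C) (vts D) := by
    intro C D hC hD hCH hDH hdis
    have hodd : ∀ C, CycF G C → C ⊆ H → Odd (negc σ C) := by
      intro C hC hCH
      by_contra hcon
      exact hpos ⟨C, hC, Nat.not_odd_iff_even.1 hcon, hCH⟩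
    rw [Set.disjoint_left]
    intro x hxC hxD
    refine hbar ⟨C, D, hC, hD, hodd C hC hCH, hodd D hD hDH, hCH, hDH, hdis, x, ?_⟩
    ext y
    constructor
    · rintro ⟨hyC, hyD⟩
      by_contra hxy
      obtain ⟨Z, hZ, hZn, hZs⟩ := pos_cycle_of_two σ hC hD hdis (hodd D hD hDH) hxy hyC hxC hyD hxD
      exact hpos ⟨Z, hZ, hZn, hZs.trans (Finset.union_subset hCH hDH)⟩
    · rintro rfl
      exact ⟨hxC, hxD⟩
  by_cases hne : H.Nonempty
  · obtain ⟨C, hC, hCH⟩ := even_cycle hG hb hne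
    have hnC : Odd (negc σ C) := by
      by_contra hcon
      exact hpos ⟨C, hC, Nat.not_odd_iff_even.1 hcon, hCH⟩
    obtain ⟨𝓕, 𝒟, h1, h2, h3, h4, h5, h6⟩ := ih (H \ C) (Finset.sdiff_ssubset hCH hC.nonempty)
      (fun e he => hG e (Finset.sdiff_subset he)) (by rw [bdm_sdiff id hCH, hb, hC.bdm, add_zero])
    have hCD : ∀ D ∈ 𝒟, Disjoint C D := fun D hD =>
      Finset.disjoint_of_subset_right (h2 D hD).2.2 Finset.disjoint_sdiff
    have hCn : C ∉ 𝒟 := by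
      intro h
      have := hCD C h
      rw [disjoint_self] at this
      exact hC.nonempty.ne_empty this
    have hvC : ∀ D ∈ 𝒟, Disjoint (vts C) (vts D) := fun D hD =>
      hvd C D hC (h2 D hD).1 hCH (fun e he => Finset.sdiff_subset ((h2 D hD).2.2 he)) (hCD D hD)
    refine ⟨𝓕, insert C 𝒟, h1, ?_, ?_, ?_, ?_, ?_⟩
    · intro D hD
      rcases Finset.mem_insert.1 hD with rfl | hD
      · exact ⟨hC, hnC, hCH⟩
      · exact ⟨(h2 D hD).1, (h2 D hD).2.1, fun e he => Finset.sdiff_subset ((h2 D hD).2.2 he)⟩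
    · intro A hA B hB hAB
      rcases Finset.mem_insert.1 hA with hA' | hA' <;>
        rcases Finset.mem_insert.1 hB with hB' | hB'
      · exact absurd (hA'.trans hB'.symm) hAB
      · exact hA' ▸ hvC B hB'
      · exact hB' ▸ (hvC A hA').symm
      · exact h3 A hA' B hB' hAB
    · intro e he
      by_cases heB : e ∈ C
      · exact Or.inr ⟨C, Finset.mem_insert_self _ _, heB⟩
      · rcases h4 e (Finset.mem_sdiff.2 ⟨he, heB⟩) with h | ⟨D, hD, heD⟩
        · exact Or.inl h
        · exact Or.inr ⟨D, Finset.mem_insert_of_mem hD, heD⟩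
    · rw [Finset.sum_insert hCn]
      have := Finset.card_sdiff_add_card_eq_card hCH
      omega
    · have := negc_sdiff σ hCH
      rw [Nat.odd_iff] at hnC
      rw [Finset.card_insert_of_notMem hCn]
      omega
  · rw [Finset.not_nonempty_iff_eq_empty] at hne
    subst hne
    exact ⟨0, ∅, by simp, by simp, by simp, by simp, by simp, by simp [negc]⟩

lemma pairing {V : Type*} {G : SimpleGraph V} (σ : Sym2 V → Bool)
    (vc : Finset (Sym2 V) → V) (𝒟 : Finset (Finset (Sym2 V))) :
    ∀ J : Finset (Sym2 V),
    (∀ C ∈ 𝒟, CycF G C ∧ Odd (negc σ C)) →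
    (∀ C ∈ 𝒟, ∀ D ∈ 𝒟, C ≠ D → Disjoint (vts C) (vts D)) →
    (∀ C ∈ 𝒟, vc C ∈ vts C) →
    ESub G J → bdm id J = ∑ C ∈ 𝒟, Pi.single (vc C) 1 →
    ∃ 𝓕 : Multiset (Finset (Sym2 V)),
      (∀ C ∈ 𝓕, IsSignedCircuit G σ (C : Set (Sym2 V))) ∧
      (∀ D ∈ 𝒟, ∀ e ∈ D, ∃ C ∈ 𝓕, e ∈ C) ∧
      (𝓕.map Finset.card).sum ≤ ∑ C ∈ 𝒟, C.card + J.card := by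
  induction 𝒟 using Finset.strongInduction with
  | H 𝒟 ih =>
  intro J hc hd hv hJ hb
  by_cases hne : 𝒟.Nonempty
  swap
  · rw [Finset.not_nonempty_iff_eq_empty] at hne
    subst hne
    exact ⟨0, by simp, by simp, by simp⟩
  obtain ⟨C, hC⟩ := hne
  have hinj : ∀ D ∈ 𝒟, D ≠ C → vc C ≠ vc D := by
    intro D hD hDC heq
    exact Set.disjoint_left.1 (hd D hD C hC hDC) (hv D hD) (heq ▸ hv C hC)
  have h1 : bdm id J (vc C) = 1 := by
    rw [hb, Finset.sum_apply, Finset.sum_eq_single C]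
    · simp
    · intro D hD hDC
      simp [hinj D hD hDC]
    · exact fun h => absurd hC h
  obtain ⟨u, huv, hu, p, hp, hpJ⟩ := trail_exists _ J rfl hJ (vc C) h1
  obtain ⟨D, hD, rfl⟩ : ∃ D ∈ 𝒟, vc D = u := by
    by_contra hcon
    push Not at hcon
    rw [hb, Finset.sum_apply, Finset.sum_eq_zero] at hu
    · exact absurd hu (by decide)
    · intro D hD
      simp [(hcon D hD).symm]
  have hDC : D ≠ C := by
    rintro rfl; exact huv rfl
  have hDe : D ∈ 𝒟.erase C := Finset.mem_erase.2 ⟨hDC, hD⟩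
  obtain ⟨B, hB, hCB, hDB, hcard⟩ := long_barbell (hc C hC).1 (hc D hD).1 (hc C hC).2 (hc D hD).2
    (hd C hC D hD hDC.symm) (hv C hC) (hv D hD) p
  have hsub : ∀ {A}, A ∈ (𝒟.erase C).erase D → A ∈ 𝒟 := fun h =>
    Finset.mem_of_mem_erase (Finset.mem_of_mem_erase h)
  obtain ⟨𝓕, f1, f2, f3⟩ := ih ((𝒟.erase C).erase D)
    ((Finset.erase_ssubset hDe).trans (Finset.erase_ssubset hC)) (J \ p.edges.toFinset)
    (fun A hA => hc A (hsub hA)) (fun A hA A' hA' => hd A (hsub hA) A' (hsub hA'))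
    (fun A hA => hv A (hsub hA)) (fun e he => hJ e (Finset.sdiff_subset he)) (by
      rw [bdm_sdiff id hpJ, trail_bdm id p hp, hb, ← Finset.add_sum_erase _ _ hC,
        ← Finset.add_sum_erase _ _ hDe]
      have e1 := z2_add_self (Pi.single (vc C) (1 : ZMod 2))
      have e2 := z2_add_self (Pi.single (vc D) (1 : ZMod 2))
      simp only [id]
      generalize (∑ x ∈ (𝒟.erase C).erase D, (Pi.single (vc x) (1 : ZMod 2) : V → ZMod 2)) = r
      calc _ = (Pi.single (vc C) (1 : ZMod 2) + Pi.single (vc C) (1 : ZMod 2)) +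
          (Pi.single (vc D) (1 : ZMod 2) + Pi.single (vc D) (1 : ZMod 2)) + r := by abel
        _ = r := by rw [e1, e2]; simp)
  refine ⟨B ::ₘ 𝓕, ?_, ?_, ?_⟩
  · intro A hA
    rcases Multiset.mem_cons.1 hA with rfl | hA
    · exact Or.inr ⟨_, _, hB⟩
    · exact f1 A hA
  · intro A hA e he
    by_cases hAC : A = C
    · subst hAC
      exact ⟨B, Multiset.mem_cons_self _ _, hCB he⟩
    by_cases hAD : A = D
    · subst hAD
      exact ⟨B, Multiset.mem_cons_self _ _, hDB he⟩
    obtain ⟨A', hA', heA'⟩ := f2 A (by simp [hAC, hAD, hA]) e he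
    exact ⟨A', Multiset.mem_cons_of_mem hA', heA'⟩
  · rw [Multiset.map_cons, Multiset.sum_cons]
    have k1 := Finset.card_sdiff_add_card_eq_card hpJ
    have k2 := Finset.add_sum_erase 𝒟 Finset.card hC
    have k3 := Finset.add_sum_erase (𝒟.erase C) Finset.card hDe
    omega

/-- Push-forward of a `ZMod 2`-chain. -/
noncomputable def pushf {V W : Type*} [Fintype V] (π : V → W) : (V → ZMod 2) →+ (W → ZMod 2) where
  toFun g := ∑ y, g y • (Pi.single (π y) (1 : ZMod 2) : W → ZMod 2)
  map_zero' := by simp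
  map_add' f g := by simp [add_smul, Finset.sum_add_distrib]

lemma pushf_single {V W : Type*} [Fintype V] (π : V → W) (y : V) :
    pushf π (Pi.single y 1) = Pi.single (π y) 1 := by
  change ∑ z, (Pi.single y (1 : ZMod 2) : V → ZMod 2) z •
    (Pi.single (π z) (1 : ZMod 2) : W → ZMod 2) = _
  rw [Finset.sum_eq_single y]
  · simp
  · intro z _ hz
    simp [hz]
  · simp

lemma pushf_bdm {V W : Type*} [Fintype V] (π : V → W) (J : Finset (Sym2 V)) :
    pushf π (bdm id J) = bdm π J := by
  rw [bdm, bdm, map_sum]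
  refine Finset.sum_congr rfl fun e _ => ?_
  induction e with
  | h a b => rw [incv_mk, incv_mk, map_add, pushf_single, pushf_single]; rfl

lemma pushf_filter {V W : Type*} [Fintype V] (π : V → W) (f : V → ZMod 2) :
    pushf π f = ∑ y ∈ Finset.univ.filter (fun y => f y ≠ 0),
      (Pi.single (π y) (1 : ZMod 2) : W → ZMod 2) := by
  change ∑ y, f y • (Pi.single (π y) (1 : ZMod 2) : W → ZMod 2) = _
  rw [Finset.sum_filter]
  refine Finset.sum_congr rfl fun y _ => ?_
  rcases z2_cases (f y) with h | h <;> simp [h]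

lemma pushf_id {V : Type*} [Fintype V] (f : V → ZMod 2) : pushf id f = f := by
  change ∑ y, f y • (Pi.single (id y) (1 : ZMod 2) : V → ZMod 2) = _
  ext x
  simp [Finset.sum_apply, Pi.single_apply]

lemma incv_eq_zero {V W : Type*} {π : V → W} {e : Sym2 V} {x : W} (h : x ∉ Sym2.map π e) :
    incv π e x = 0 := by
  induction e with
  | h a b =>
    rw [Sym2.map_mk, Sym2.mem_iff, not_or] at h
    rw [incv_mk]
    simp [h.1, h.2]

lemma incv_sum {V W : Type*} [Fintype W] (π : V → W) (e : Sym2 V) : ∑ x, incv π e x = 0 := by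
  induction e with
  | h a b =>
    rw [incv_mk]
    simp only [Pi.add_apply, Finset.sum_add_distrib, Finset.sum_pi_single']
    simp
    decide

lemma bdm_sum {V W : Type*} [Fintype W] (π : V → W) (J : Finset (Sym2 V)) :
    ∑ x, bdm π J x = 0 := by
  simp only [bdm, Finset.sum_apply]
  rw [Finset.sum_comm]
  exact Finset.sum_eq_zero fun e _ => incv_sum π e

lemma forest_leaves {V W : Type*} [Fintype W] (π : V → W) (J : Finset (Sym2 V))
    (hne : J.Nonempty) (hind : ∀ Z ⊆ J, bdm π Z = 0 → Z = ∅) :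
    (∀ e ∈ J, ¬ (Sym2.map π e).IsDiag) ∧
    ∃ x y, x ≠ y ∧ (J.filter (fun e => x ∈ Sym2.map π e)).card = 1 ∧
      (J.filter (fun e => y ∈ Sym2.map π e)).card = 1 := by
  have hdiag : ∀ e ∈ J, ¬ (Sym2.map π e).IsDiag := by
    intro e he hd
    have h0 : incv π e = 0 := by
      induction e with
      | h a b =>
        rw [Sym2.map_mk, Sym2.mk_isDiag_iff] at hd
        rw [incv_mk, hd, z2_add_self]
    have := hind {e} (by simpa using he) (by simp [bdm, h0])
    simp at this
  refine ⟨hdiag, ?_⟩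
  set N : Finset W := Finset.univ.filter (fun x => ∃ e ∈ J, x ∈ Sym2.map π e) with hN
  set deg : W → ℕ := fun x => (J.filter (fun e => x ∈ Sym2.map π e)).card with hdeg
  have hout : ∀ Z ⊆ J, ∀ x, x ∉ N → bdm π Z x = 0 := by
    intro Z hZ x hx
    rw [bdm, Finset.sum_apply]
    refine Finset.sum_eq_zero fun e he => incv_eq_zero fun hxe => hx ?_
    simp only [hN, Finset.mem_filter, Finset.mem_univ, true_and]
    exact ⟨e, hZ he, hxe⟩
  have hNne : N.Nonempty := by
    obtain ⟨e, he⟩ := hne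
    induction e with
    | h a b =>
      refine ⟨π a, ?_⟩
      simp only [hN, Finset.mem_filter, Finset.mem_univ, true_and]
      exact ⟨_, he, by simp⟩
  obtain ⟨n₀, hn₀⟩ := hNne
  have hcard : J.card ≤ (N.erase n₀).card := by
    have : J.powerset.card ≤ (N.erase n₀).powerset.card := by
      refine Finset.card_le_card_of_injOn
        (fun Z => (N.erase n₀).filter (fun x => bdm π Z x = 1)) ?_ ?_
      · intro Z _
        simp only [Finset.coe_powerset, Set.mem_preimage, Set.mem_powerset_iff, Finset.coe_subset]
        exact Finset.filter_subset _ _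
      · intro Z hZ Z' hZ' heq
        simp only [Finset.coe_powerset, Set.mem_preimage, Set.mem_powerset_iff,
          Finset.coe_subset] at hZ hZ'
        have hsub : symmDiff Z Z' ⊆ J := by
          intro e he
          rw [Finset.mem_symmDiff] at he
          rcases he with he | he
          · exact hZ he.1
          · exact hZ' he.1
        have hz : ∀ x, x ≠ n₀ → bdm π (symmDiff Z Z') x = 0 := by
          intro x hx
          by_cases hxN : x ∈ N
          · rw [bdm_symmDiff, Pi.add_apply]
            have hx' : x ∈ N.erase n₀ := Finset.mem_erase.2 ⟨hx, hxN⟩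
            have h1 : bdm π Z x = 1 ↔ bdm π Z' x = 1 := by
              have := Finset.ext_iff.1 heq x
              simpa [hx', hx, hxN] using this
            rcases z2_cases (bdm π Z x) with h | h <;> rcases z2_cases (bdm π Z' x) with h' | h' <;>
              rw [h, h'] at h1 ⊢ <;> revert h1 <;> decide
          · exact hout _ hsub x hxN
        have hz0 : bdm π (symmDiff Z Z') n₀ = 0 := by
          have := bdm_sum π (symmDiff Z Z')
          rwa [Finset.sum_eq_single n₀ (fun x _ hx => hz x hx) (by simp)] at this
        have := hind _ hsub (by
          ext x
          by_cases hx : x = n₀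
          · rw [hx, hz0]; rfl
          · rw [hz x hx]; rfl)
        exact symmDiff_eq_bot.1 this
    rw [Finset.card_powerset, Finset.card_powerset] at this
    exact (Nat.pow_le_pow_iff_right (by norm_num)).1 this
  have hcard' : J.card + 1 ≤ N.card := by
    rw [Finset.card_erase_of_mem hn₀] at hcard
    have := Finset.card_pos.2 ⟨n₀, hn₀⟩
    omega
  have hsum : ∑ x ∈ N, deg x = 2 * J.card := by
    have h1 := Finset.sum_card_bipartiteAbove_eq_sum_card_bipartiteBelow
        (s := N) (t := J) (fun x e => x ∈ Sym2.map π e)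
    have h2 : ∑ x ∈ N, deg x = ∑ e ∈ J,
      (Finset.bipartiteBelow (fun x e => x ∈ Sym2.map π e) N e).card := by
      rw [← h1]
      refine Finset.sum_congr rfl fun x _ => ?_
      simp only [hdeg, Finset.bipartiteAbove]
    rw [h2, Finset.sum_congr rfl (g := fun _ => 2)]
    · simp [mul_comm]
    · intro e he
      rw [← Sym2.card_toFinset_of_not_isDiag _ (hdiag e he)]
      congr 1
      ext x
      simp only [Finset.bipartiteBelow, Finset.mem_filter, Sym2.mem_toFinset, hN,
        Finset.mem_univ, true_and]
      constructor
      · exact fun h => h.2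
      · exact fun h => ⟨⟨e, he, h⟩, h⟩
  by_contra hcon
  push Not at hcon
  have hA : (N.filter (fun x => deg x = 1)).card ≤ 1 := by
    by_contra hlt
    push Not at hlt
    obtain ⟨x, hx, y, hy, hxy⟩ := Finset.one_lt_card.1 hlt
    exact hcon x y hxy (Finset.mem_filter.1 hx).2 (Finset.mem_filter.1 hy).2
  have hge : ∑ x ∈ N, 2 ≤ ∑ x ∈ N, (deg x + if deg x = 1 then 1 else 0) := by
    refine Finset.sum_le_sum fun x hx => ?_
    have hpos : 0 < deg x := by
      simp only [hN, Finset.mem_filter, Finset.mem_univ, true_and] at hx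
      obtain ⟨e, he, hxe⟩ := hx
      exact Finset.card_pos.2 ⟨e, Finset.mem_filter.2 ⟨he, hxe⟩⟩
    split_ifs <;> omega
  rw [Finset.sum_add_distrib, hsum, ← Finset.card_filter] at hge
  simp at hge
  omega

lemma leaf_gen {V W : Type*} (π : V → W) (J : Finset (Sym2 V)) (x : W)
    (hd : ∀ e ∈ J, ¬ (Sym2.map π e).IsDiag)
    (hx : (J.filter (fun e => x ∈ Sym2.map π e)).card = 1) :
    bdm π J x = 1 ∧ ∃ y, π y = x ∧ ∀ z, π z = x → bdm id J z = (Pi.single y 1 : V → ZMod 2) z := by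
  obtain ⟨e, he⟩ := Finset.card_eq_one.1 hx
  have hmem : ∀ e', e' ∈ J ∧ x ∈ Sym2.map π e' ↔ e' = e := by
    intro e'
    have := Finset.ext_iff.1 he e'
    simpa using this
  obtain ⟨heJ, hxe⟩ := (hmem e).2 rfl
  have hde := hd e heJ
  obtain ⟨a, b, rfl, ha⟩ : ∃ a b, e = s(a, b) ∧ π a = x := by
    clear he hmem
    induction e with
    | h a b =>
      rw [Sym2.map_mk, Sym2.mem_iff] at hxe
      rcases hxe with h | h
      · exact ⟨a, b, rfl, h.symm⟩
      · exact ⟨b, a, Sym2.eq_swap, h.symm⟩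
  have hb : π b ≠ x := by
    intro hb
    rw [Sym2.map_mk, Sym2.mk_isDiag_iff] at hde
    exact hde (ha.trans hb.symm)
  constructor
  · rw [bdm, Finset.sum_apply, Finset.sum_eq_single s(a, b)]
    · rw [incv_mk]
      simp [ha, hb.symm]
    · intro e' he' hne
      refine incv_eq_zero fun h => hne ((hmem e').1 ⟨he', h⟩)
    · exact fun h => absurd heJ h
  · refine ⟨a, ha, fun z hz => ?_⟩
    rw [bdm, Finset.sum_apply, Finset.sum_eq_single s(a, b)]
    · rw [incv_mk]
      have : z ≠ b := by rintro rfl; exact hb hz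
      simp [this]
    · intro e' he' hne
      refine incv_eq_zero fun h => hne ((hmem e').1 ⟨he', ?_⟩)
      rw [Sym2.map_id, id] at h
      rw [Sym2.mem_map]
      exact ⟨z, h, hz⟩
    · exact fun h => absurd heJ h

/-- Contract each member of `𝒟` to its chosen vertex. -/
noncomputable def proj {V : Type*} (𝒟 : Finset (Finset (Sym2 V))) (vc : Finset (Sym2 V) → V)
    (y : V) : V :=
  if h : ∃ C ∈ 𝒟, y ∈ vts C then vc h.choose else y

lemma proj_of_mem {V : Type*} {𝒟 : Finset (Finset (Sym2 V))} (vc : Finset (Sym2 V) → V)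
    (hd : ∀ C ∈ 𝒟, ∀ D ∈ 𝒟, C ≠ D → Disjoint (vts C) (vts D)) {C : Finset (Sym2 V)}
    (hC : C ∈ 𝒟) {y : V} (hy : y ∈ vts C) : proj 𝒟 vc y = vc C := by
  have h : ∃ C ∈ 𝒟, y ∈ vts C := ⟨C, hC, hy⟩
  rw [proj, dif_pos h]
  have h2 := h.choose_spec
  by_cases hne : h.choose = C
  · rw [hne]
  · exact absurd hy (Set.disjoint_left.1 (hd _ h2.1 C hC hne) h2.2)

lemma proj_eq_iff {V : Type*} {𝒟 : Finset (Finset (Sym2 V))} {vc : Finset (Sym2 V) → V}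
    (hd : ∀ C ∈ 𝒟, ∀ D ∈ 𝒟, C ≠ D → Disjoint (vts C) (vts D))
    (hv : ∀ C ∈ 𝒟, vc C ∈ vts C) {C : Finset (Sym2 V)}
    (hC : C ∈ 𝒟) {y : V} : proj 𝒟 vc y = vc C ↔ y ∈ vts C := by
  refine ⟨fun h => ?_, proj_of_mem vc hd hC⟩
  by_cases hy : ∃ D ∈ 𝒟, y ∈ vts D
  · obtain ⟨D, hD, hyD⟩ := hy
    rw [proj_of_mem vc hd hD hyD] at h
    by_cases hDC : D = C
    · exact hDC ▸ hyD
    · exact absurd (hv C hC) (Set.disjoint_left.1 (hd D hD C hC hDC) (h ▸ hv D hD))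
  · rw [proj, dif_neg hy] at h
    exact h ▸ hv C hC

lemma edges_disj {V : Type*} {C D : Finset (Sym2 V)} (h : Disjoint (vts C) (vts D)) :
    Disjoint C D := by
  rw [Finset.disjoint_left]
  intro e he he'
  induction e with
  | h a b =>
    exact Set.disjoint_left.1 h (show a ∈ vts C from ⟨_, he, by simp⟩) ⟨_, he', by simp⟩

lemma lift_aux {V : Type*} {G : SimpleGraph V} {𝒟 : Finset (Finset (Sym2 V))}
    {vc : Finset (Sym2 V) → V}
    (hc : ∀ C ∈ 𝒟, CycF G C)
    (hd : ∀ C ∈ 𝒟, ∀ D ∈ 𝒟, C ≠ D → Disjoint (vts C) (vts D))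
    (hv : ∀ C ∈ 𝒟, vc C ∈ vts C) (Y : Finset V) :
    ∃ K : Finset (Sym2 V),
      bdm id K = ∑ y ∈ Y, (Pi.single y 1 + Pi.single (proj 𝒟 vc y) 1 : V → ZMod 2) ∧
      ∀ e ∈ K, ∃ C ∈ 𝒟, e ∈ C ∧ ∃ y ∈ vts C, y ∈ Y := by
  induction Y using Finset.induction_on with
  | empty => exact ⟨∅, by simp [bdm], by simp⟩
  | insert y Y hy ih =>
    obtain ⟨K, hK, hKs⟩ := ih
    rw [Finset.sum_insert hy]
    by_cases hyp : y = proj 𝒟 vc y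
    · refine ⟨K, ?_, ?_⟩
      · rw [← hyp, z2_add_self, zero_add, hK]
      · intro e he
        obtain ⟨C, hC, heC, z, hz, hzY⟩ := hKs e he
        exact ⟨C, hC, heC, z, hz, Finset.mem_insert_of_mem hzY⟩
    · have hex : ∃ C ∈ 𝒟, y ∈ vts C := by
        by_contra hcon
        exact hyp (by rw [proj, dif_neg hcon])
      obtain ⟨C, hC, hyC⟩ := hex
      rw [proj_of_mem vc hd hC hyC] at hyp ⊢
      obtain ⟨q, q₀, hq, -, -, hqC, -, -⟩ := two_paths (hc C hC) hyp hyC (hv C hC)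
      refine ⟨symmDiff q.edges.toFinset K, ?_, ?_⟩
      · rw [bdm_symmDiff, hK, trail_bdm id q hq.isTrail]; rfl
      · intro e he
        rw [Finset.mem_symmDiff] at he
        rcases he with he | he
        · exact ⟨C, hC, hqC ▸ Finset.mem_union_left _ he.1, y, hyC, Finset.mem_insert_self _ _⟩
        · obtain ⟨C, hC, heC, z, hz, hzY⟩ := hKs e he.1
          exact ⟨C, hC, heC, z, hz, Finset.mem_insert_of_mem hzY⟩

lemma lift_bd {V : Type*} [Fintype V] {G : SimpleGraph V} {𝒟 : Finset (Finset (Sym2 V))}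
    {vc : Finset (Sym2 V) → V}
    (hc : ∀ C ∈ 𝒟, CycF G C)
    (hd : ∀ C ∈ 𝒟, ∀ D ∈ 𝒟, C ≠ D → Disjoint (vts C) (vts D))
    (hv : ∀ C ∈ 𝒟, vc C ∈ vts C) (f : V → ZMod 2) (hf : pushf (proj 𝒟 vc) f = 0) :
    ∃ K : Finset (Sym2 V), bdm id K = f ∧
      ∀ e ∈ K, ∃ C ∈ 𝒟, e ∈ C ∧ ∃ y ∈ vts C, f y ≠ 0 := by
  obtain ⟨K, hK, hKs⟩ := lift_aux hc hd hv (Finset.univ.filter (fun y => f y ≠ 0))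
  refine ⟨K, ?_, ?_⟩
  · rw [hK, Finset.sum_add_distrib, ← pushf_filter (proj 𝒟 vc), hf, add_zero]
    have := pushf_filter (id : V → V) f
    rw [pushf_id] at this
    exact this.symm
  · intro e he
    obtain ⟨C, hC, heC, z, hz, hzY⟩ := hKs e he
    exact ⟨C, hC, heC, z, hz, (Finset.mem_filter.1 hzY).2⟩

lemma tjoin {V : Type*} {G : SimpleGraph V} (hG : G.Connected) (r : V)
    (vc : Finset (Sym2 V) → V) (𝒟 : Finset (Finset (Sym2 V))) :
    ∃ K : Finset (Sym2 V), ESub G K ∧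
      bdm id K = ∑ C ∈ 𝒟, (Pi.single (vc C) 1 : V → ZMod 2) + 𝒟.card • Pi.single r 1 := by
  induction 𝒟 using Finset.induction_on with
  | empty => exact ⟨∅, by simp [ESub], by simp [bdm]⟩
  | insert C 𝒟 hC ih =>
    obtain ⟨K, hK, hb⟩ := ih
    obtain ⟨L, hL, hbL⟩ := reach_bd (hG.preconnected (vc C) r)
    refine ⟨symmDiff L K, esub_symmDiff hL hK, ?_⟩
    rw [bdm_symmDiff, hbL, hb, Finset.sum_insert hC, Finset.card_insert_of_notMem hC, succ_nsmul]
    abel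

lemma key_join {V : Type*} [Fintype V] {G : SimpleGraph V} (hG : G.Connected)
    (hbr : ∀ e ∈ G.edgeSet, ¬ G.IsBridge e) (E : Finset (Sym2 V)) (hE : ∀ e, e ∈ E ↔ e ∈ G.edgeSet)
    (𝒟 : Finset (Finset (Sym2 V))) (hc : ∀ C ∈ 𝒟, CycF G C)
    (hd : ∀ C ∈ 𝒟, ∀ D ∈ 𝒟, C ≠ D → Disjoint (vts C) (vts D))
    (hne : 𝒟.Nonempty) (hev : Even 𝒟.card) :
    ∃ a ∈ 𝒟, ∃ b ∈ 𝒟, a ≠ b ∧ ∃ (vc : Finset (Sym2 V) → V) (J : Finset (Sym2 V)),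
      (∀ C ∈ 𝒟, vc C ∈ vts C) ∧ ESub G J ∧
      bdm id J = ∑ C ∈ 𝒟, (Pi.single (vc C) 1 : V → ZMod 2) ∧
      2 * J.card + a.card + b.card ≤ E.card := by
  have : Nonempty V := hG.nonempty
  obtain ⟨vc, hv⟩ : ∃ vc : Finset (Sym2 V) → V, ∀ C ∈ 𝒟, vc C ∈ vts C := by
    have h : ∀ C : Finset (Sym2 V), ∃ v, C ∈ 𝒟 → v ∈ vts C := by
      intro C
      by_cases hC : C ∈ 𝒟
      · obtain ⟨e, he⟩ := (hc C hC).nonempty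
        induction e with
        | h a b => exact ⟨a, fun _ => ⟨_, he, by simp⟩⟩
      · exact ⟨Classical.arbitrary V, fun h => absurd h hC⟩
    choose vc hvc using h
    exact ⟨vc, hvc⟩
  have hpv : ∀ C ∈ 𝒟, proj 𝒟 vc (vc C) = vc C := fun C hC => proj_of_mem vc hd hC (hv C hC)
  set U : Finset (Sym2 V) := 𝒟.biUnion id with hU
  have hmemU : ∀ {e}, e ∈ U ↔ ∃ C ∈ 𝒟, e ∈ C := by
    intro e; simp [hU]
  have hUE : U ⊆ E := by
    intro e he
    obtain ⟨C, hC, heC⟩ := hmemU.1 he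
    exact (hE e).2 ((hc C hC).esub e heC)
  -- a good join outside the cycles
  obtain ⟨J₀, hJ₀, hbJ₀⟩ := tjoin hG (Classical.arbitrary V) vc 𝒟
  have hzero : 𝒟.card • (Pi.single (Classical.arbitrary V) 1 : V → ZMod 2) = 0 := by
    obtain ⟨k, hk⟩ := hev
    rw [hk, add_nsmul, z2_add_self]
  rw [hzero, add_zero] at hbJ₀
  obtain ⟨J', hJ'E, hJ'b, hJ'c⟩ := avg_bd E (E \ U) J₀ (fun e he => (hE e).2 (hJ₀ e he)) (by
    intro e he
    have heG : e ∈ G.edgeSet := (hE e).1 (Finset.sdiff_subset he)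
    have h1 := hbr e heG
    rw [isBridge_iff_forall_cycle_notMem heG] at h1
    push Not at h1
    obtain ⟨u, p, hp, hep⟩ := h1
    have hC : CycF G p.edges.toFinset := ⟨u, p, hp, rfl⟩
    exact ⟨_, fun e he => (hE e).2 (hC.esub e he), hC.bdm id, List.mem_toFinset.2 hep⟩)
  have hUzero : ∀ e ∈ U, incv (proj 𝒟 vc) e = 0 := by
    intro e he
    obtain ⟨C, hC, heC⟩ := hmemU.1 he
    induction e with
    | h a b =>
      rw [incv_mk, proj_of_mem vc hd hC (y := a) ⟨_, heC, by simp⟩,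
        proj_of_mem vc hd hC (y := b) ⟨_, heC, by simp⟩, z2_add_self]
  have hgood : bdm (proj 𝒟 vc) (J' ∩ (E \ U)) = ∑ C ∈ 𝒟, (Pi.single (vc C) 1 : V → ZMod 2) := by
    have h1 : bdm (proj 𝒟 vc) J' = ∑ C ∈ 𝒟, (Pi.single (vc C) 1 : V → ZMod 2) := by
      rw [← pushf_bdm, hJ'b, hbJ₀, map_sum]
      refine Finset.sum_congr rfl fun C hC => ?_
      rw [pushf_single, hpv C hC]
    rw [← h1, bdm, bdm]
    refine Finset.sum_subset Finset.inter_subset_left fun e he hne => hUzero e ?_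
    by_contra heU
    exact hne (Finset.mem_inter.2 ⟨he, Finset.mem_sdiff.2 ⟨hJ'E he, heU⟩⟩)
  obtain ⟨J₁, hJ₁, hmin⟩ := Finset.exists_min_image
    ((E \ U).powerset.filter (fun J => bdm (proj 𝒟 vc) J =
      ∑ C ∈ 𝒟, (Pi.single (vc C) 1 : V → ZMod 2))) Finset.card
    ⟨J' ∩ (E \ U), Finset.mem_filter.2 ⟨Finset.mem_powerset.2 Finset.inter_subset_right, hgood⟩⟩
  rw [Finset.mem_filter, Finset.mem_powerset] at hJ₁
  obtain ⟨hJ₁s, hJ₁b⟩ := hJ₁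
  have hJ₁c : 2 * J₁.card ≤ (E \ U).card := by
    have := hmin (J' ∩ (E \ U))
      (Finset.mem_filter.2 ⟨Finset.mem_powerset.2 Finset.inter_subset_right, hgood⟩)
    omega
  have hind : ∀ Z ⊆ J₁, bdm (proj 𝒟 vc) Z = 0 → Z = ∅ := by
    intro Z hZ hZb
    have h1 := hmin (J₁ \ Z) (by
      rw [Finset.mem_filter, Finset.mem_powerset]
      exact ⟨fun e he => hJ₁s (Finset.sdiff_subset he), by rw [bdm_sdiff _ hZ, hZb, add_zero, hJ₁b]⟩)
    have h2 := Finset.card_sdiff_add_card_eq_card hZ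
    rw [← Finset.card_eq_zero]
    omega
  -- boundary sums evaluated at a vertex of a cycle
  have heval : ∀ vc' : Finset (Sym2 V) → V, (∀ C ∈ 𝒟, vc' C ∈ vts C) → ∀ C ∈ 𝒟, ∀ z ∈ vts C,
      (∑ C ∈ 𝒟, (Pi.single (vc' C) 1 : V → ZMod 2)) z = (Pi.single (vc' C) 1 : V → ZMod 2) z := by
    intro vc' hvc' C hC z hz
    rw [Finset.sum_apply, Finset.sum_eq_single C]
    · intro D hD hDC
      have : z ≠ vc' D := by
        rintro rfl
        exact Set.disjoint_left.1 (hd D hD C hC hDC) (hvc' D hD) hz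
      simp [this]
    · exact fun h => absurd hC h
  have hJ₁ne : J₁.Nonempty := by
    obtain ⟨C, hC⟩ := hne
    rw [Finset.nonempty_iff_ne_empty]
    rintro rfl
    have h1 := heval vc hv C hC (vc C) (hv C hC)
    rw [← hJ₁b, bdm_empty] at h1
    simp at h1
  obtain ⟨hdiag, x, y, hxy, hx, hy⟩ := forest_leaves (proj 𝒟 vc) J₁ hJ₁ne hind
  have hleaf : ∀ x, (J₁.filter (fun e => x ∈ Sym2.map (proj 𝒟 vc) e)).card = 1 →
      ∃ C ∈ 𝒟, vc C = x ∧ ∃ y ∈ vts C, ∀ z ∈ vts C,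
        bdm id J₁ z = (Pi.single y 1 : V → ZMod 2) z := by
    intro x hx
    obtain ⟨h1, y, hy, hz⟩ := leaf_gen (proj 𝒟 vc) J₁ x hdiag hx
    obtain ⟨C, hC, rfl⟩ : ∃ C ∈ 𝒟, vc C = x := by
      by_contra hcon
      push Not at hcon
      rw [hJ₁b, Finset.sum_apply, Finset.sum_eq_zero] at h1
      · exact absurd h1 (by decide)
      · intro C hC
        simp [(hcon C hC).symm]
    exact ⟨C, hC, rfl, y, (proj_eq_iff hd hv hC).1 hy, fun z hzC => hz z (proj_of_mem vc hd hC hzC)⟩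
  obtain ⟨a, ha, rfl, ya, hya, hza⟩ := hleaf x hx
  obtain ⟨b, hb, rfl, yb, hyb, hzb⟩ := hleaf y hy
  have hab : a ≠ b := by
    rintro rfl; exact hxy rfl
  set vc' : Finset (Sym2 V) → V := fun C => if C = a then ya else if C = b then yb else vc C
    with hvc'def
  have hvc'a : vc' a = ya := by simp [hvc'def]
  have hvc'b : vc' b = yb := by simp [hvc'def, hab.symm]
  have hvc' : ∀ C ∈ 𝒟, vc' C ∈ vts C := by
    intro C hC
    by_cases h1 : C = a
    · rw [h1, hvc'a]; exact hya
    by_cases h2 : C = b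
    · rw [h2, hvc'b]; exact hyb
    simp only [hvc'def, h1, h2, if_false]
    exact hv C hC
  obtain ⟨K, hKb, hKs⟩ := lift_bd hc hd hv
    (bdm id J₁ + ∑ C ∈ 𝒟, (Pi.single (vc' C) 1 : V → ZMod 2)) (by
      rw [map_add, pushf_bdm, hJ₁b, map_sum]
      rw [Finset.sum_congr rfl (g := fun C => (Pi.single (vc C) 1 : V → ZMod 2)) (s₁ := 𝒟)
        (f := fun C => pushf (proj 𝒟 vc) (Pi.single (vc' C) 1))]
      · exact z2_add_self _
      · intro C hC
        rw [pushf_single, proj_of_mem vc hd hC (hvc' C hC)])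
  set F₂ : Finset (Sym2 V) := ((𝒟.erase a).erase b).biUnion id with hF₂
  have hmemF : ∀ {e}, e ∈ F₂ ↔ ∃ C, C ∈ 𝒟 ∧ C ≠ a ∧ C ≠ b ∧ e ∈ C := by
    intro e
    simp only [hF₂, Finset.mem_biUnion, Finset.mem_erase, id]
    constructor
    · rintro ⟨C, ⟨h1, h2, h3⟩, h4⟩; exact ⟨C, h3, h2, h1, h4⟩
    · rintro ⟨C, h3, h2, h1, h4⟩; exact ⟨C, ⟨h1, h2, h3⟩, h4⟩
  have hKF : K ⊆ F₂ := by
    intro e he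
    obtain ⟨C, hC, heC, z, hz, hfz⟩ := hKs e he
    refine hmemF.2 ⟨C, hC, ?_, ?_, heC⟩
    · rintro rfl
      refine hfz ?_
      rw [Pi.add_apply, heval vc' hvc' C hC z hz, hza z hz, hvc'a]
      exact CharTwo.add_self_eq_zero _
    · rintro rfl
      refine hfz ?_
      rw [Pi.add_apply, heval vc' hvc' C hC z hz, hzb z hz, hvc'b]
      exact CharTwo.add_self_eq_zero _
  obtain ⟨K', hK'F, hK'b, hK'c⟩ := avg_bd F₂ F₂ K hKF (by
    intro e he
    obtain ⟨C, hC, h1, h2, heC⟩ := hmemF.1 he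
    exact ⟨C, fun e' he' => hmemF.2 ⟨C, hC, h1, h2, he'⟩, (hc C hC).bdm id, heC⟩)
  rw [Finset.inter_eq_left.2 hK'F] at hK'c
  have hF₂U : F₂ ⊆ U := by
    intro e he
    obtain ⟨C, hC, h1, h2, heC⟩ := hmemF.1 he
    exact hmemU.2 ⟨C, hC, heC⟩
  have hdisj : Disjoint J₁ K' := by
    rw [Finset.disjoint_left]
    intro e he he'
    exact (Finset.mem_sdiff.1 (hJ₁s he)).2 (hF₂U (hK'F he'))
  refine ⟨a, ha, b, hb, hab, vc', J₁ ∪ K', hvc', ?_, ?_, ?_⟩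
  · intro e he
    rw [← hE]
    rcases Finset.mem_union.1 he with he | he
    · exact Finset.sdiff_subset (hJ₁s he)
    · exact hUE (hF₂U (hK'F he))
  · rw [bdm_union id hdisj, hK'b, hKb, ← add_assoc, z2_add_self, zero_add]
  · have c1 := Finset.card_union_of_disjoint hdisj
    have d1 : Disjoint a b := edges_disj (hd a ha b hb hab)
    have d2 : Disjoint (a ∪ b) F₂ := by
      rw [Finset.disjoint_left]
      intro e he he'
      obtain ⟨C, hC, h1, h2, heC⟩ := hmemF.1 he'
      rcases Finset.mem_union.1 he with he | he
      · exact Finset.disjoint_left.1 (edges_disj (hd C hC a ha h1)) heC he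
      · exact Finset.disjoint_left.1 (edges_disj (hd C hC b hb h2)) heC he
    have c2 := Finset.card_union_of_disjoint d1
    have c3 := Finset.card_union_of_disjoint d2
    have c4 : ((a ∪ b) ∪ F₂).card ≤ U.card := by
      apply Finset.card_le_card
      intro e he
      rcases Finset.mem_union.1 he with he | he
      · rcases Finset.mem_union.1 he with he | he
        · exact hmemU.2 ⟨a, ha, he⟩
        · exact hmemU.2 ⟨b, hb, he⟩
      · exact hF₂U he
    have c5 := Finset.card_sdiff_add_card_eq_card hUE
    omega

lemma cyc_disj_of {V : Type*} {G : SimpleGraph V} {C₁ C₂ : Set (Sym2 V)} {S₁ S₂ : Set V}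
    (h₁ : IsCycleSet G C₁ S₁) (h₂ : IsCycleSet G C₂ S₂)
    (h : ∀ x y, x ∈ S₁ → x ∈ S₂ → y ∈ S₁ → y ∈ S₂ → x = y) : Disjoint C₁ C₂ := by
  obtain ⟨v, w, hw, rfl, rfl⟩ := h₁
  obtain ⟨v', w', hw', rfl, rfl⟩ := h₂
  rw [Set.disjoint_left]
  intro e he he'
  induction e with
  | h a b =>
    have hab : G.Adj a b := w.edges_subset_edgeSet he
    exact hab.ne (h a b (w.fst_mem_support_of_mem_edges he) (w'.fst_mem_support_of_mem_edges he')
      (w.snd_mem_support_of_mem_edges he) (w'.snd_mem_support_of_mem_edges he'))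

lemma cycset_sub {V : Type*} {G : SimpleGraph V} {C : Set (Sym2 V)} {S : Set V}
    (h : IsCycleSet G C S) : C ⊆ G.edgeSet := by
  obtain ⟨v, w, hw, rfl, rfl⟩ := h
  intro e he
  exact w.edges_subset_edgeSet he

lemma tau_le_of_barbell {V : Type*} {G : SimpleGraph V} {σ : Sym2 V → Bool}
    {B C₁ C₂ : Set (Sym2 V)} (h : IsBarbellWith G σ B C₁ C₂) :
    tau G σ ≤ C₁.ncard + C₂.ncard := by
  unfold tau
  rw [if_pos ⟨B, C₁, C₂, h⟩]
  exact Nat.sInf_le ⟨B, C₁, C₂, h, rfl⟩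

lemma tau_le_edges {V : Type*} [Fintype V] (G : SimpleGraph V) (σ : Sym2 V → Bool) :
    tau G σ ≤ G.edgeSet.ncard := by
  by_cases h : ∃ B, IsBarbell G σ B
  · obtain ⟨B, C₁, C₂, hB⟩ := h
    refine (tau_le_of_barbell hB).trans ?_
    have key : ∃ S₁ S₂, IsCycleSet G C₁ S₁ ∧ IsCycleSet G C₂ S₂ ∧
        ∀ x y, x ∈ S₁ → x ∈ S₂ → y ∈ S₁ → y ∈ S₂ → x = y := by
      rcases hB with ⟨S₁, S₂, h1, h2, ⟨v, hv⟩, -⟩ | ⟨S₁, S₂, u, v, p, h1, h2, hd, -⟩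
      · refine ⟨S₁, S₂, h1.1, h2.1, fun x y a b c d => ?_⟩
        have e1 : x ∈ S₁ ∩ S₂ := ⟨a, b⟩
        have e2 : y ∈ S₁ ∩ S₂ := ⟨c, d⟩
        rw [hv] at e1 e2
        exact e1.trans e2.symm
      · exact ⟨S₁, S₂, h1.1, h2.1, fun x y a b _ _ => (Set.disjoint_left.1 hd a b).elim⟩
    obtain ⟨S₁, S₂, h1, h2, hx⟩ := key
    rw [← Set.ncard_union_eq (cyc_disj_of h1 h2 hx) (Set.toFinite _) (Set.toFinite _)]
    exact Set.ncard_le_ncard (Set.union_subset (cycset_sub h1) (cycset_sub h2)) (Set.toFinite _)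
  · unfold tau
    rw [if_neg h]

lemma del_conn {V : Type*} {G : SimpleGraph V} (hG : G.Connected) {e : Sym2 V}
    (h : ¬ G.IsBridge e) : (G.deleteEdges {e}).Connected := by
  induction e with
  | h u v => exact hG.connected_delete_edge_of_not_isBridge h

lemma cut_mem {V : Type*} {G : SimpleGraph V} (hG : G.Connected) {H : Finset (Sym2 V)}
    (hH : ESub G H) (hb : bdm id H = 0) {e f : Sym2 V} (hf : ¬ G.IsBridge f)
    (hcut : ¬ (G.deleteEdges {e, f}).Connected) (he : e ∈ H) : f ∈ H := by
  by_contra hfH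
  apply hcut
  have h1 : (G.deleteEdges {f}).Connected := del_conn hG hf
  have h2 : ¬ (G.deleteEdges {f}).IsBridge e := by
    induction e with
    | h u v =>
      rw [isBridge_iff, not_not, deleteEdges_deleteEdges]
      obtain ⟨p, -, hp⟩ := even_edge hH hb he
      refine ⟨p.toDeleteEdges _ ?_⟩
      intro e' he' hmem
      have hm := Finset.mem_erase.1 (hp (List.mem_toFinset.2 he'))
      rcases hmem with h | h
      · exact hfH ((show e' = f from h) ▸ hm.2)
      · exact hm.1 h
  have h3 := del_conn h1 h2
  rw [deleteEdges_deleteEdges] at h3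
  rwa [show ({e, f} : Set (Sym2 V)) = {f} ∪ {e} by ext; simp]

lemma cover_even {V : Type*} [Fintype V] {G : SimpleGraph V} (σ : Sym2 V → Bool)
    (hG : G.Connected) (hbr : ∀ e, ¬ G.IsBridge e) {H : Finset (Sym2 V)} (hH : ESub G H)
    (hb : bdm id H = 0) (hn : Even (negc σ H)) :
    ∃ 𝓕 : Multiset (Finset (Sym2 V)),
      (∀ C ∈ 𝓕, IsSignedCircuit G σ (C : Set (Sym2 V))) ∧
      (∀ e ∈ H, ∃ C ∈ 𝓕, e ∈ C) ∧
      2 * (𝓕.map Finset.card).sum + tau G σ ≤ 2 * H.card + G.edgeSet.ncard := by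
  obtain ⟨𝓕₁, 𝒟, h1, h2, h3, h4, h5, h6⟩ := decomp σ H hH hb
  by_cases hne : 𝒟.Nonempty
  · have hev : Even 𝒟.card := by
      rw [Nat.even_iff] at hn ⊢; omega
    obtain ⟨a, ha, b, hb', hab, vc, J, hv, hJ, hJb, hJc⟩ := key_join hG (fun e _ => hbr e)
      G.edgeSet.toFinset (by simp) 𝒟 (fun C hC => (h2 C hC).1) h3 hne hev
    obtain ⟨𝓕₂, g1, g2, g3⟩ := pairing σ vc 𝒟 J (fun C hC => ⟨(h2 C hC).1, (h2 C hC).2.1⟩) h3 hv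
      hJ hJb
    obtain ⟨p⟩ := hG.preconnected (vc a) (vc b)
    obtain ⟨B, hB, -⟩ := long_barbell (h2 a ha).1 (h2 b hb').1 (h2 a ha).2.1 (h2 b hb').2.1
      (h3 a ha b hb' hab) (hv a ha) (hv b hb') p
    have ht := tau_le_of_barbell hB
    rw [Set.ncard_coe_finset, Set.ncard_coe_finset] at ht
    refine ⟨𝓕₁ + 𝓕₂, ?_, ?_, ?_⟩
    · intro C hC
      rcases Multiset.mem_add.1 hC with hC | hC
      · exact h1 C hC
      · exact g1 C hC
    · intro e he
      rcases h4 e he with ⟨C, hC, heC⟩ | ⟨C, hC, heC⟩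
      · exact ⟨C, Multiset.mem_add.2 (Or.inl hC), heC⟩
      · obtain ⟨D, hD, heD⟩ := g2 C hC e heC
        exact ⟨D, Multiset.mem_add.2 (Or.inr hD), heD⟩
    · rw [Multiset.map_add, Multiset.sum_add, Set.ncard_eq_toFinset_card']
      omega
  · rw [Finset.not_nonempty_iff_eq_empty] at hne
    subst hne
    refine ⟨𝓕₁, h1, ?_, ?_⟩
    · intro e he
      rcases h4 e he with h | ⟨C, hC, -⟩
      · exact h
      · simp at hC
    · have := tau_le_edges G σ
      simp only [Finset.sum_empty] at h5
      omega

lemma exists_even {V : Type*} [Fintype V] {G : SimpleGraph V} (σ : Sym2 V → Bool)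
    (hpos : (gplus G σ).Connected) {S : Finset (Sym2 V)}
    (hS : ∀ e ∈ S, e ∈ G.edgeSet ∧ σ e = true) (hSe : Even S.card) :
    ∃ H : Finset (Sym2 V), ESub G H ∧ bdm id H = 0 ∧ Even (negc σ H) ∧ S ⊆ H ∧
      2 * H.card + (nonBridgeEdges (gplus G σ)).ncard ≤ 2 * G.edgeSet.ncard := by
  have hge : ∀ e, e ∈ (gplus G σ).edgeSet ↔ e ∈ G.edgeSet ∧ ¬ σ e = true := by
    intro e
    unfold gplus
    rw [edgeSet_deleteEdges]
    exact Iff.rfl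
  obtain ⟨K, hK, hKb⟩ := join_edges hpos S
  set M := (gplus G σ).edgeSet.toFinset with hM
  set N := (nonBridgeEdges (gplus G σ)).toFinset with hN
  have hNM : N ⊆ M := by
    intro e he
    rw [hN, Set.mem_toFinset] at he
    exact Set.mem_toFinset.2 he.1
  obtain ⟨J, hJM, hJb, hJc⟩ := avg_bd M N K (fun e he => Set.mem_toFinset.2 (hK e he)) (by
    intro e he
    rw [hN, Set.mem_toFinset] at he
    obtain ⟨he1, he2⟩ := he
    rw [isBridge_iff_forall_cycle_notMem he1] at he2
    push Not at he2
    obtain ⟨u, p, hp, hep⟩ := he2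
    have hc : CycF (gplus G σ) p.edges.toFinset := ⟨u, p, hp, rfl⟩
    exact ⟨p.edges.toFinset, fun e he => Set.mem_toFinset.2 (hc.esub e he), hc.bdm id,
      List.mem_toFinset.2 hep⟩)
  have hJ : ∀ e ∈ J, e ∈ G.edgeSet ∧ ¬ σ e = true := fun e he =>
    (hge e).1 (Set.mem_toFinset.1 (hJM he))
  have hdis : Disjoint S J := by
    rw [Finset.disjoint_left]
    intro e he he'
    exact (hJ e he').2 (hS e he).2
  refine ⟨S ∪ J, ?_, ?_, ?_, Finset.subset_union_left, ?_⟩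
  · intro e he
    rcases Finset.mem_union.1 he with he | he
    · exact (hS e he).1
    · exact (hJ e he).1
  · rw [bdm_union _ hdis, hJb, hKb, z2_add_self]
  · have : negc σ (S ∪ J) = S.card := by
      unfold negc
      congr 1
      ext e
      simp only [Finset.mem_filter, Finset.mem_union]
      constructor
      · rintro ⟨h | h, h'⟩
        · exact h
        · exact absurd h' (hJ e h).2
      · intro h; exact ⟨Or.inl h, (hS e h).2⟩
    rwa [this]
  · rw [Set.ncard_eq_toFinset_card', Set.ncard_eq_toFinset_card', Finset.card_union_of_disjoint hdis]
    change 2 * (S.card + J.card) + N.card ≤ _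
    have hSM : Disjoint S M := by
      rw [Finset.disjoint_left]
      intro e he he'
      exact ((hge e).1 (Set.mem_toFinset.1 he')).2 (hS e he).2
    have c1 : S.card + M.card ≤ G.edgeSet.toFinset.card := by
      rw [← Finset.card_union_of_disjoint hSM]
      apply Finset.card_le_card
      intro e he
      rw [Set.mem_toFinset]
      rcases Finset.mem_union.1 he with he | he
      · exact (hS e he).1
      · exact ((hge e).1 (Set.mem_toFinset.1 he)).1
    have c2 := Finset.card_sdiff_add_card_eq_card hNM
    have c3 := Finset.card_le_card (Finset.sdiff_subset_sdiff hJM (Finset.Subset.refl N))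
    have c4 := Finset.card_sdiff_add_card_inter J N
    omega

lemma stmt3_main {V : Type*} [Fintype V] (G : SimpleGraph V) (σ : Sym2 V → Bool)
    (h2ec : TwoEdgeConnected G) (hpos : (gplus G σ).Connected)
    (S : Set (Sym2 V)) (hS : S ⊆ negEdgeSet G σ) (hSeven : Even S.ncard) :
    ∃ 𝓕 : Multiset (Set (Sym2 V)),
      (∀ C ∈ 𝓕, IsSignedCircuit G σ C) ∧
      (∀ e ∈ S, ∃ C ∈ 𝓕, e ∈ C) ∧
      (∀ e f : Sym2 V, IsTwoEdgeCut G e f → (e ∈ S ∨ f ∈ S) →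
        (∃ C ∈ 𝓕, e ∈ C) ∧ (∃ C ∈ 𝓕, f ∈ C)) ∧
      2 * circuitLength 𝓕 + (nonBridgeEdges (gplus G σ)).ncard + tau G σ
        ≤ 3 * G.edgeSet.ncard := by
  rw [Set.ncard_eq_toFinset_card'] at hSeven
  obtain ⟨H, hH, hHb, hHn, hSH, hHc⟩ := exists_even σ hpos (S := S.toFinset)
    (fun e he => hS (Set.mem_toFinset.1 he)) hSeven
  obtain ⟨𝓕, h1, h2, h3⟩ := cover_even σ h2ec.1 h2ec.2.2 hH hHb hHn
  have hcov : ∀ e ∈ H, ∃ C ∈ 𝓕.map (fun C : Finset (Sym2 V) => (C : Set (Sym2 V))), e ∈ C := by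
    intro e he
    obtain ⟨C, hC, heC⟩ := h2 e he
    exact ⟨_, Multiset.mem_map_of_mem _ hC, heC⟩
  refine ⟨𝓕.map (fun C : Finset (Sym2 V) => (C : Set (Sym2 V))), ?_, ?_, ?_, ?_⟩
  · intro C hC
    obtain ⟨D, hD, rfl⟩ := Multiset.mem_map.1 hC
    exact h1 D hD
  · intro e he
    exact hcov e (hSH (Set.mem_toFinset.2 he))
  · rintro e f ⟨-, -, -, hbe, hbf, hcut⟩ (he | hf)
    · have he := hSH (Set.mem_toFinset.2 he)
      exact ⟨hcov e he, hcov f (cut_mem h2ec.1 hH hHb hbf hcut he)⟩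
    · have hf := hSH (Set.mem_toFinset.2 hf)
      rw [Set.pair_comm] at hcut
      exact ⟨hcov e (cut_mem h2ec.1 hH hHb hbe hcut hf), hcov f hf⟩
  · have : circuitLength (𝓕.map (fun C : Finset (Sym2 V) => (C : Set (Sym2 V))))
        = (𝓕.map Finset.card).sum := by
      unfold circuitLength
      rw [Multiset.map_map]
      congr 1
      apply Multiset.map_congr rfl
      intro C _
      exact Set.ncard_coe_finset C
    rw [this]
    omega

end Aux

/-- key covering lemma for 2-edge-connected signed graphs with `G⁺`
connected and `S ⊆ E⁻(G,σ)` of even size. -/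
theorem stmt3 {V : Type*} [Fintype V] (G : SimpleGraph V) (σ : Sym2 V → Bool)
    (h2ec : TwoEdgeConnected G) (hpos : (gplus G σ).Connected)
    (S : Set (Sym2 V)) (hS : S ⊆ negEdgeSet G σ) (hSeven : Even S.ncard) :
    ∃ 𝓕 : Multiset (Set (Sym2 V)),
      (∀ C ∈ 𝓕, IsSignedCircuit G σ C) ∧
      (∀ e ∈ S, ∃ C ∈ 𝓕, e ∈ C) ∧
      (∀ e f : Sym2 V, IsTwoEdgeCut G e f → (e ∈ S ∨ f ∈ S) →
        (∃ C ∈ 𝓕, e ∈ C) ∧ (∃ C ∈ 𝓕, f ∈ C)) ∧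
      2 * circuitLength 𝓕 + (nonBridgeEdges (gplus G σ)).ncard + tau G σ
        ≤ 3 * G.edgeSet.ncard := by
  exact stmt3_main G σ h2ec hpos S hS hSeven
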